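/- arXiv:1207.0535 — 3 statements merged into one kernel-verified Lean document; each statement's English description precedes it below -/
import Mathlib

section
/- For m, n ≥ 3, the state complexities of Uₘ(a,b,c) ∪ (Uₙ(a,b,c))ᴿ, Uₘ(a,b,c) ∩ (Uₙ(a,b,c))ᴿ, Uₘ(a,b,c) \ (Uₙ(a,b,c))ᴿ, and (Uₙ(a,b,c))ᴿ \ Uₘ(a,b,c) are all exactly m·2ⁿ − (m − 1). -/
namespace SCPaper

/-- Reversal of a language. -/
def rev {α : Type} (L : Language α) : Language α := {w | w.reverse ∈ L}

/-- Union of two languages. -/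
def lunion {α : Type} (K L : Language α) : Language α := {w | w ∈ K ∨ w ∈ L}

/-- Intersection of two languages. -/
def linter {α : Type} (K L : Language α) : Language α := {w | w ∈ K ∧ w ∈ L}

/-- Difference of two languages. -/
def ldiff {α : Type} (K L : Language α) : Language α := {w | w ∈ K ∧ w ∉ L}

/-- Symmetric difference of two languages. -/
def lsymm {α : Type} (K L : Language α) : Language α := lunion (ldiff K L) (ldiff L K)

/-- Sizes (numbers of states) of complete DFAs recognizing `L`. -/
def complexitySet {α : Type} (L : Language α) : Set ℕ :=
  {n | ∃ M : DFA α (Fin n), M.accepts = L}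

/-- A language is regular if it is recognized by some finite DFA. -/
def Regular {α : Type} (L : Language α) : Prop := (complexitySet L).Nonempty

/-- State complexity: the number of states of a minimal DFA for `L`. -/
noncomputable def sc {α : Type} (L : Language α) : ℕ := sInf (complexitySet L)

/-- The cyclic permutation (0,1,…,n−1). -/
def cyc (n : ℕ) (i : Fin n) : Fin n :=
  ⟨(i.val + 1) % n, Nat.mod_lt _ (Nat.lt_of_le_of_lt (Nat.zero_le _) i.isLt)⟩

/-- The transposition (0,1). -/
def tp01 (n : ℕ) (i : Fin n) : Fin n :=
  if i.val = 0 then ⟨1 % n, Nat.mod_lt _ (Nat.lt_of_le_of_lt (Nat.zero_le _) i.isLt)⟩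
  else if i.val = 1 then ⟨0, Nat.lt_of_le_of_lt (Nat.zero_le _) i.isLt⟩
  else i

/-- The singular map sending n−1 to 0 and fixing everything else. -/
def sing (n : ℕ) (i : Fin n) : Fin n :=
  if i.val = n - 1 then ⟨0, Nat.lt_of_le_of_lt (Nat.zero_le _) i.isLt⟩ else i

/-- The transposition (n−2, n−1). -/
def tpTop (n : ℕ) (i : Fin n) : Fin n :=
  if i.val = n - 1 then ⟨n - 2, by have := i.isLt; omega⟩
  else if i.val = n - 2 then ⟨n - 1, by have := i.isLt; omega⟩
  else i

/-- The singular map sending n−1 to n−2 and fixing everything else. -/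
def singTop (n : ℕ) (i : Fin n) : Fin n :=
  if i.val = n - 1 then ⟨n - 2, by have := i.isLt; omega⟩ else i

/-- 𝒰ₙ(a,b,∅): binary alphabet, a = cycle (0,…,n−1), b = transposition (0,1),
initial state 0, final state n−1. -/
def U2dfa (n : ℕ) (h : 0 < n) : DFA (Fin 2) (Fin n) where
  step := fun i x => if x = 0 then cyc n i else tp01 n i
  start := ⟨0, h⟩
  accept := {i | i.val = n - 1}

def U2 (n : ℕ) (h : 0 < n) : Language (Fin 2) := (U2dfa n h).accepts

/-- 𝒰ₙ(a,b,c): a = cycle, b = transposition (0,1), c = (n−1 ↦ 0). -/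
def Udfa (n : ℕ) (h : 0 < n) : DFA (Fin 3) (Fin n) where
  step := fun i x => if x = 0 then cyc n i else if x = 1 then tp01 n i else sing n i
  start := ⟨0, h⟩
  accept := {i | i.val = n - 1}

def U (n : ℕ) (h : 0 < n) : Language (Fin 3) := (Udfa n h).accepts

/-- 𝒰ₙ(a,b,c) with final state set {0}. -/
def U0dfa (n : ℕ) (h : 0 < n) : DFA (Fin 3) (Fin n) where
  step := fun i x => if x = 0 then cyc n i else if x = 1 then tp01 n i else sing n i
  start := ⟨0, h⟩
  accept := {i | i.val = 0}

def U0 (n : ℕ) (h : 0 < n) : Language (Fin 3) := (U0dfa n h).accepts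

/-- 𝒰ₙ(a,b,c,d): a = cycle, b = transposition (0,1), c = (n−1 ↦ 0), d = identity. -/
def U4dfa (n : ℕ) (h : 0 < n) : DFA (Fin 4) (Fin n) where
  step := fun i x =>
    if x = 0 then cyc n i else if x = 1 then tp01 n i else if x = 2 then sing n i else i
  start := ⟨0, h⟩
  accept := {i | i.val = n - 1}

def U4 (n : ℕ) (h : 0 < n) : Language (Fin 4) := (U4dfa n h).accepts

/-- 𝒰ₙ(d,c,b,a): d = cycle, c = transposition (0,1), b = (n−1 ↦ 0), a = identity. -/
def U4dcbaDfa (n : ℕ) (h : 0 < n) : DFA (Fin 4) (Fin n) where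
  step := fun i x =>
    if x = 3 then cyc n i else if x = 2 then tp01 n i else if x = 1 then sing n i else i
  start := ⟨0, h⟩
  accept := {i | i.val = n - 1}

def U4dcba (n : ℕ) (h : 0 < n) : Language (Fin 4) := (U4dcbaDfa n h).accepts

/-- 𝒱ₙ(a,b,c,d): a = cycle, b = transposition (n−2,n−1), c = (n−1 ↦ n−2), d = identity. -/
def Vdfa (n : ℕ) (h : 0 < n) : DFA (Fin 4) (Fin n) where
  step := fun i x =>
    if x = 0 then cyc n i else if x = 1 then tpTop n i else if x = 2 then singTop n i else i
  start := ⟨0, h⟩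
  accept := {i | i.val = n - 1}

def V (n : ℕ) (h : 0 < n) : Language (Fin 4) := (Vdfa n h).accepts

/-- 𝒱ₙ(d,c,b,a): d = cycle, c = transposition (n−2,n−1), b = (n−1 ↦ n−2), a = identity. -/
def VdcbaDfa (n : ℕ) (h : 0 < n) : DFA (Fin 4) (Fin n) where
  step := fun i x =>
    if x = 3 then cyc n i else if x = 2 then tpTop n i else if x = 1 then singTop n i else i
  start := ⟨0, h⟩
  accept := {i | i.val = n - 1}

def Vdcba (n : ℕ) (h : 0 < n) : Language (Fin 4) := (VdcbaDfa n h).accepts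

/-- Direct product of two DFAs with a chosen set of final states. -/
def prodDFA {α σ₁ σ₂ : Type} (M : DFA α σ₁) (N : DFA α σ₂) (acc : Set (σ₁ × σ₂)) :
    DFA α (σ₁ × σ₂) where
  step := fun p x => (M.step p.1 x, N.step p.2 x)
  start := (M.start, N.start)
  accept := acc


/-- Chinese-remainder style pairing k ↦ (k mod m, k mod n). -/
def toPair (m n : ℕ) (hm : 0 < m) (hn : 0 < n) (k : Fin (m * n)) : Fin m × Fin n :=
  (⟨k.val % m, Nat.mod_lt _ hm⟩, ⟨k.val % n, Nat.mod_lt _ hn⟩)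

/-- Componentwise successor on the product of two cyclic automata. -/
def prodSucc (m n : ℕ) (p : Fin m × Fin n) : Fin m × Fin n := (cyc m p.1, cyc n p.2)

/-- One-letter subset transition of the reversed NFA of 𝒰ₙ(a,b,c). -/
def rstep (n : ℕ) (h : 0 < n) (S : Set (Fin n)) (x : Fin 3) : Set (Fin n) :=
  {q | (Udfa n h).step q x ∈ S}

/-- Action of a word on subsets in the reversed NFA of 𝒰ₙ(a,b,c). -/
def rword (n : ℕ) (h : 0 < n) (S : Set (Fin n)) (w : List (Fin 3)) : Set (Fin n) :=
  w.foldl (rstep n h) S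

end SCPaper

open SCPaper

open SCPaper


namespace SCAux

/-- The pair of maps realized by a word. -/
def Rl (m n : ℕ) (hm : 0 < m) (hn : 0 < n) (T : Fin m → Fin m) (B : Fin n → Fin n) : Prop :=
  ∃ w : List (Fin 3), (∀ t, (Udfa m hm).evalFrom t w = T t) ∧
    ∀ q, (Udfa n hn).evalFrom q w.reverse = B q

/-- Predecessor. -/
def pc (n : ℕ) (i : Fin n) : Fin n :=
  if i.val = 0 then ⟨n - 1, by have := i.isLt; omega⟩ else ⟨i.val - 1, by have := i.isLt; omega⟩

lemma cyc_val (n : ℕ) (i : Fin n) : (cyc n i).val = if i.val + 1 = n then 0 else i.val + 1 := by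
  have := i.isLt
  unfold cyc
  split_ifs with h
  · simp [h]
  · exact Nat.mod_eq_of_lt (by omega)

lemma pc_val (n : ℕ) (i : Fin n) : (pc n i).val = if i.val = 0 then n - 1 else i.val - 1 := by
  unfold pc; split_ifs <;> rfl

lemma tp_val (n : ℕ) (hn : 2 ≤ n) (i : Fin n) :
    (tp01 n i).val = if i.val = 0 then 1 else if i.val = 1 then 0 else i.val := by
  unfold tp01; split_ifs
  · exact Nat.mod_eq_of_lt (by omega)
  · rfl
  · rfl

lemma sing_val (n : ℕ) (i : Fin n) : (sing n i).val = if i.val = n - 1 then 0 else i.val := by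
  unfold sing; split_ifs <;> rfl

lemma pc_cyc (n : ℕ) (i : Fin n) : pc n (cyc n i) = i := by
  have := i.isLt
  apply Fin.ext; rw [pc_val, cyc_val]; grind

lemma cyc_pc (n : ℕ) (i : Fin n) : cyc n (pc n i) = i := by
  have := i.isLt
  apply Fin.ext; rw [cyc_val, pc_val]; grind

lemma cyc_iter_val (n k : ℕ) (i : Fin n) : ((cyc n)^[k] i).val = (i.val + k) % n := by
  induction k with
  | zero => simp [Nat.mod_eq_of_lt i.isLt]
  | succ k ih =>
    rw [Function.iterate_succ_apply']
    simp only [cyc, ih]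
    rw [Nat.mod_add_mod]; rfl

section
variable {m n : ℕ} {hm : 0 < m} {hn : 0 < n}

lemma Rl.id : Rl m n hm hn (fun t => t) (fun q => q) := ⟨[], by simp, by simp⟩

lemma Rl.comp {T₁ T₂ : Fin m → Fin m} {B₁ B₂ : Fin n → Fin n}
    (h₁ : Rl m n hm hn T₁ B₁) (h₂ : Rl m n hm hn T₂ B₂) :
    Rl m n hm hn (fun t => T₂ (T₁ t)) (fun q => B₁ (B₂ q)) := by
  obtain ⟨w₁, a₁, b₁⟩ := h₁
  obtain ⟨w₂, a₂, b₂⟩ := h₂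
  refine ⟨w₁ ++ w₂, fun t => ?_, fun q => ?_⟩
  · rw [DFA.evalFrom_of_append, a₁, a₂]
  · rw [List.reverse_append, DFA.evalFrom_of_append, b₂, b₁]

lemma Rl.a : Rl m n hm hn (cyc m) (cyc n) := ⟨[0], by simp [Udfa], by simp [Udfa]⟩
lemma Rl.b : Rl m n hm hn (tp01 m) (tp01 n) := ⟨[1], by simp [Udfa], by simp [Udfa]⟩
lemma Rl.c : Rl m n hm hn (sing m) (sing n) := ⟨[2], by simp [Udfa], by simp [Udfa]⟩

lemma Rl.ak (k : ℕ) : Rl m n hm hn ((cyc m)^[k]) ((cyc n)^[k]) := by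
  induction k with
  | zero => exact Rl.id
  | succ k ih =>
    have := Rl.comp ih Rl.a
    convert this using 1
    · funext t; rw [Function.iterate_succ_apply']
    · funext t; rw [Function.iterate_succ_apply]
  
lemma cyc_iter_pred (n k : ℕ) (hk : 0 < k) (h : n ∣ k) : (cyc n)^[k - 1] = pc n := by
  funext i
  have : cyc n ((cyc n)^[k-1] i) = i := by
    rw [← Function.iterate_succ_apply' (cyc n)]
    apply Fin.ext
    rw [cyc_iter_val]
    obtain ⟨r, rfl⟩ := h
    rw [show (n * r - 1).succ = n * r by omega]
    simp [Nat.mod_eq_of_lt i.isLt]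
  rw [← this, pc_cyc, this]

lemma Rl.p : Rl m n hm hn (pc m) (pc n) := by
  have := Rl.ak (hm := hm) (hn := hn) (m * n - 1)
  rwa [cyc_iter_pred m _ (by positivity) (by simp), cyc_iter_pred n _ (by positivity) (by simp)] at this

lemma Rl.pk (k : ℕ) : Rl m n hm hn ((pc m)^[k]) ((pc n)^[k]) := by
  induction k with
  | zero => exact Rl.id
  | succ k ih =>
    have := Rl.comp ih Rl.p
    convert this using 1
    · funext t; rw [Function.iterate_succ_apply']
    · funext t; rw [Function.iterate_succ_apply]

/-- pullback maps realized with the token 0 isolated -/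
def Iso (m n : ℕ) (hm : 0 < m) (hn : 0 < n) (B : Fin n → Fin n) : Prop :=
  ∃ T, Rl m n hm hn T B ∧ ∀ t, (T t).val = 0 ↔ t.val = 0

lemma Iso.comp {B₁ B₂ : Fin n → Fin n} (h₁ : Iso m n hm hn B₁) (h₂ : Iso m n hm hn B₂) :
    Iso m n hm hn (fun q => B₁ (B₂ q)) := by
  obtain ⟨T₁, r₁, e₁⟩ := h₁
  obtain ⟨T₂, r₂, e₂⟩ := h₂
  exact ⟨_, r₁.comp r₂, fun t => by rw [e₂, e₁]⟩

lemma Iso.ab (h3 : 3 ≤ m) : Iso m n hm hn (fun q => cyc n (tp01 n q)) := by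
  refine ⟨_, Rl.a.comp Rl.b, fun t => ?_⟩
  have := t.isLt
  rw [tp_val _ (by omega), cyc_val]; grind

lemma Iso.ba (h3 : 3 ≤ m) : Iso m n hm hn (fun q => tp01 n (pc n q)) := by
  refine ⟨_, Rl.b.comp Rl.p, fun t => ?_⟩
  have := t.isLt
  rw [pc_val, tp_val _ (by omega)]; grind

lemma Iso.aca (h3 : 3 ≤ m) : Iso m n hm hn (fun q => cyc n (sing n (pc n q))) := by
  refine ⟨_, Rl.a.comp (Rl.c.comp Rl.p), fun t => ?_⟩
  have := t.isLt
  rw [pc_val, sing_val, cyc_val]; grind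

lemma Iso.aabaa (h3 : 3 ≤ m) :
    Iso m n hm hn (fun q => cyc n (cyc n (tp01 n (pc n (pc n q))))) := by
  refine ⟨_, Rl.a.comp (Rl.a.comp (Rl.b.comp (Rl.p.comp Rl.p))), fun t => ?_⟩
  have := t.isLt
  rw [pc_val, pc_val, tp_val _ (by omega), cyc_val, cyc_val]; grind

/-- Key separation lemma, normalized. -/
lemma key0 (h3 : 3 ≤ m) (hn3 : 3 ≤ n) (k : Fin n) :
    ∃ B, Iso m n hm hn B ∧ B ⟨n - 1, by omega⟩ = k := by
  have h0 : ∃ B, Iso m n hm hn B ∧ B ⟨n - 1, by omega⟩ = ⟨0, hn⟩ := by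
    refine ⟨_, Iso.ab h3, ?_⟩
    apply Fin.ext; rw [cyc_val, tp_val _ (by omega)]; simp only []; grind
  obtain ⟨B, hB, e⟩ := h0
  have hk : ∀ j (hj : j < n), 2 ≤ j → ∃ B, Iso m n hm hn B ∧ B ⟨n - 1, by omega⟩ = ⟨j, hj⟩ := by
    intro j hj h2
    induction j, h2 using Nat.le_induction with
    | base =>
      refine ⟨_, (Iso.ab h3).comp hB, ?_⟩
      rw [e]
      apply Fin.ext; rw [cyc_val, tp_val _ (by omega)]; simp only []; grind
    | succ j h2 ih =>
      obtain ⟨B, hB, e⟩ := ih (by omega)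
      refine ⟨_, (Iso.ab h3).comp hB, ?_⟩
      rw [e]
      apply Fin.ext; rw [cyc_val, tp_val _ (by omega)]; simp only []; grind
  obtain ⟨k, hkn⟩ := k
  match k, hkn with
  | 0, _ => exact ⟨B, hB, e⟩
  | 1, _ =>
    refine ⟨_, (Iso.aca h3).comp hB, ?_⟩
    rw [e]
    apply Fin.ext; rw [cyc_val, sing_val, pc_val]; simp only []; grind
  | k + 2, hkn => exact hk _ hkn (by omega)

lemma pc_inj (n : ℕ) : Function.Injective (pc n) :=
  fun x y h => by rw [← cyc_pc n x, h, cyc_pc]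

lemma pc_iter_self (k : ℕ) (i : Fin n) (hk : i.val = k) : (((pc n)^[k]) i).val = 0 := by
  induction k generalizing i with
  | zero => simpa using hk
  | succ k ih =>
    rw [Function.iterate_succ_apply]
    apply ih
    rw [pc_val]; grind

lemma pc_iter_cyc (k : ℕ) (i : Fin n) : ((pc n)^[k]) ((cyc n)^[k] i) = i :=
  (Function.LeftInverse.iterate (pc_cyc n) k) i

lemma cyc_iter_pc (k : ℕ) (i : Fin n) : ((cyc n)^[k]) ((pc n)^[k] i) = i :=
  (Function.LeftInverse.iterate (cyc_pc n) k) i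

lemma key (h3 : 3 ≤ m) (hn3 : 3 ≤ n) (i : Fin m) (k : Fin n) :
    ∃ w : List (Fin 3), (∀ t, ((Udfa m hm).evalFrom t w).val = m - 1 ↔ t = i) ∧
      (Udfa n hn).evalFrom ⟨0, hn⟩ w.reverse = k := by
  obtain ⟨B, ⟨T, hR, hT⟩, e⟩ := key0 (hm := hm) (hn := hn) h3 hn3 ((cyc n)^[i.val] k)
  obtain ⟨w, hw1, hw2⟩ := (Rl.pk (hm := hm) (hn := hn) i.val).comp (hR.comp Rl.p)
  refine ⟨w, fun t => ?_, ?_⟩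
  · rw [hw1, pc_val]
    have h1 := hT ((pc m)^[i.val] t)
    have h2 : ((pc m)^[i.val] t).val = 0 ↔ t = i := by
      constructor
      · intro h
        apply (pc_inj m).iterate i.val
        apply Fin.ext
        rw [h, pc_iter_self _ _ rfl]
      · rintro rfl; exact pc_iter_self _ _ rfl
    rw [← h2, ← h1]
    have := (T ((pc m)^[i.val] t)).isLt
    grind
  · rw [hw2]
    have : pc n ⟨0, hn⟩ = ⟨n - 1, by omega⟩ := by apply Fin.ext; rw [pc_val]; simp
    simp only [this, e, pc_iter_cyc]

/-! ### Reachability -/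

lemma conj_swap {r s : Fin n → Fin n} (h : ∀ q, r (s q) = q) (h' : ∀ q, s (r q) = q) (x y q : Fin n) :
    r (Equiv.swap x y (s q)) = Equiv.swap (r x) (r y) q := by
  let ρ : Equiv.Perm (Fin n) := ⟨r, s, h', h⟩
  have := Equiv.symm_trans_swap_trans x y ρ
  exact congrArg (fun σ => σ q) this

def Sw (m n : ℕ) (hm : 0 < m) (hn : 0 < n) (x y : Fin n) : Prop :=
  Iso m n hm hn (fun q => Equiv.swap x y q)

lemma Sw.symm {x y : Fin n} (h : Sw m n hm hn x y) : Sw m n hm hn y x := by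
  unfold Sw at *; rwa [Equiv.swap_comm]

lemma Sw.conj {x y u v : Fin n} (h : Sw m n hm hn x y) (h' : Sw m n hm hn u v) :
    Sw m n hm hn (Equiv.swap u v x) (Equiv.swap u v y) := by
  have := h'.comp (h.comp h')
  unfold Sw
  convert this using 1
  funext q
  exact (conj_swap (fun q => Equiv.swap_apply_self u v q) (fun q => Equiv.swap_apply_self u v q) x y q).symm

lemma Sw.succ (h3 : 3 ≤ m) (hn3 : 3 ≤ n) (j : ℕ) (h2 : 2 ≤ j) (hj : j < n) :
    Sw m n hm hn ⟨j, hj⟩ (cyc n ⟨j, hj⟩) := by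
  induction j, h2 using Nat.le_induction with
  | base =>
    unfold Sw
    convert Iso.aabaa (hm := hm) (hn := hn) h3 using 1
    funext q
    have ht : ∀ q, tp01 n q = Equiv.swap ⟨0, hn⟩ ⟨1, by omega⟩ q := by
      intro q
      rw [Equiv.swap_apply_def]
      apply Fin.ext
      rw [tp_val _ (by omega)]
      simp only [Fin.ext_iff, apply_ite Fin.val]
    rw [ht, conj_swap (r := fun q => cyc n (cyc n q)) (s := fun q => pc n (pc n q))
      (fun q => by simp only [cyc_pc]) (fun q => by simp only [pc_cyc])]
    have e0 : cyc n (cyc n ⟨0, hn⟩) = ⟨2, by omega⟩ := by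
      apply Fin.ext; rw [cyc_val, cyc_val]; simp only []; grind
    have e1 : cyc n (⟨1, by omega⟩ : Fin n) = ⟨2, by omega⟩ := by
      apply Fin.ext; rw [cyc_val]; simp only []; grind
    rw [e0, e1]
  | succ j h2 ih =>
    have ih := ih (by omega)
    have := (Iso.ab h3).comp (Iso.comp ih (Iso.ba h3))
    unfold Sw
    convert this using 1
    funext q
    have := q.isLt
    have tt : ∀ q, tp01 n (tp01 n q) = q := by
      intro q
      apply Fin.ext; rw [tp_val _ (by omega), tp_val _ (by omega)]; grind
    rw [conj_swap (r := fun q => cyc n (tp01 n q)) (s := fun q => tp01 n (pc n q))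
      (fun q => by simp only [tt, cyc_pc]) (fun q => by simp only [tt, pc_cyc])]
    congr 2
    · apply Fin.ext; rw [cyc_val, tp_val _ (by omega)]; simp only []; grind
    · apply Fin.ext
      rw [cyc_val, cyc_val, tp_val _ (by omega), cyc_val]; simp only []; grind

lemma Sw.refl (x : Fin n) : Sw m n hm hn x x := by
  refine ⟨fun t => t, ?_, fun t => Iff.rfl⟩
  simpa using Rl.id

lemma Sw.trans {x y z : Fin n} (h : Sw m n hm hn x y) (h' : Sw m n hm hn y z) :
    Sw m n hm hn x z := by
  by_cases hxy : x = y
  · exact hxy ▸ h'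
  by_cases hxz : x = z
  · subst hxz; exact Sw.refl _
  have := h.conj h'
  rwa [Equiv.swap_apply_of_ne_of_ne hxy hxz, Equiv.swap_apply_left] at this

lemma Sw.two (h3 : 3 ≤ m) (hn3 : 3 ≤ n) (x : Fin n) (hx : x.val ≠ 1) :
    Sw m n hm hn ⟨2, by omega⟩ x := by
  have hk : ∀ j (hj : j < n), 2 ≤ j → Sw m n hm hn ⟨2, by omega⟩ ⟨j, hj⟩ := by
    intro j hj h2
    induction j, h2 using Nat.le_induction with
    | base => exact Sw.refl _
    | succ j h2 ih =>
      refine (ih (by omega)).trans ?_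
      convert Sw.succ h3 hn3 j h2 (by omega) using 1
      apply Fin.ext; rw [cyc_val]; simp only []; grind
  by_cases h0 : x.val = 0
  · refine (hk (n-1) (by omega) (by omega)).trans ?_
    convert Sw.succ h3 hn3 (n-1) (by omega) (by omega) using 1
    apply Fin.ext; rw [cyc_val]; simp only []; grind
  · exact hk x.val x.isLt (by omega)

lemma Sw.all (h3 : 3 ≤ m) (hn3 : 3 ≤ n) (x y : Fin n) (hx : x.val ≠ 1) (hy : y.val ≠ 1) :
    Sw m n hm hn x y := (Sw.two h3 hn3 x hx).symm.trans (Sw.two h3 hn3 y hy)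

/-- token 0 fixed -/
def Fx (m n : ℕ) (hm : 0 < m) (hn : 0 < n) (B : Fin n → Fin n) : Prop :=
  ∃ T, Rl m n hm hn T B ∧ T ⟨0, hm⟩ = ⟨0, hm⟩

lemma Iso.fx {B : Fin n → Fin n} (h : Iso m n hm hn B) : Fx m n hm hn B := by
  obtain ⟨T, h, e⟩ := h
  exact ⟨T, h, Fin.ext ((e _).2 rfl)⟩

lemma Fx.comp {B₁ B₂ : Fin n → Fin n} (h₁ : Fx m n hm hn B₁) (h₂ : Fx m n hm hn B₂) :
    Fx m n hm hn (fun q => B₁ (B₂ q)) := by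
  obtain ⟨T₁, r₁, e₁⟩ := h₁
  obtain ⟨T₂, r₂, e₂⟩ := h₂
  exact ⟨_, r₁.comp r₂, by rw [e₁, e₂]⟩

/-- copying the bit x into y -/
def Cp (m n : ℕ) (hm : 0 < m) (hn : 0 < n) (x y : Fin n) : Prop :=
  Fx m n hm hn (fun q => if q = y then x else q)

lemma Cp.conj {x y u v : Fin n} (h : Cp m n hm hn x y) (h' : Sw m n hm hn u v) :
    Cp m n hm hn (Equiv.swap u v x) (Equiv.swap u v y) := by
  have h' := Iso.fx h'
  have := h'.comp (h.comp h')
  unfold Cp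
  convert this using 1
  funext q
  have : q = Equiv.swap u v y ↔ Equiv.swap u v q = y := by
    constructor
    · rintro rfl; simp
    · rintro rfl; simp
  simp only [this]
  split_ifs <;> simp

lemma Cp.base (h3 : 3 ≤ m) : Cp m n hm hn ⟨0, hn⟩ ⟨n - 1, by omega⟩ := by
  refine ⟨sing m, ?_, ?_⟩
  · convert Rl.c (hm := hm) (hn := hn) using 1
    funext q
    apply Fin.ext; rw [sing_val, apply_ite Fin.val]; simp only [Fin.ext_iff]
  · apply Fin.ext; rw [sing_val]; simp

lemma Cp.all (h3 : 3 ≤ m) (hn3 : 3 ≤ n) (x y : Fin n) (hx : x.val ≠ 1) (hy : y.val ≠ 1)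
    (hxy : x ≠ y) : Cp m n hm hn x y := by
  have h1 := (Cp.base (hm := hm) (hn := hn) h3).conj (Sw.all h3 hn3 ⟨0, hn⟩ x (by simp) hx)
  rw [Equiv.swap_apply_left] at h1
  set y' := Equiv.swap (⟨0, hn⟩ : Fin n) x ⟨n - 1, by omega⟩ with hy'
  have hne : x ≠ y' := by
    rw [hy', ← Equiv.swap_apply_left (⟨0, hn⟩ : Fin n) x]
    simp only [Equiv.swap_apply_left]
    intro h
    have := congrArg (Equiv.swap (⟨0, hn⟩ : Fin n) x) h
    simp [Fin.ext_iff] at this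
    omega
  have hy1 : y'.val ≠ 1 := by
    rw [hy', Equiv.swap_apply_def]; split_ifs <;> (simp_all; try omega)
  have h2 := h1.conj (Sw.all h3 hn3 y' y hy1 hy)
  rwa [Equiv.swap_apply_left, Equiv.swap_apply_of_ne_of_ne hne hxy] at h2

def Rc (m n : ℕ) (hm : 0 < m) (hn : 0 < n) (S : Set (Fin n)) : Prop :=
  ∃ B, Fx m n hm hn B ∧ S = {q | (B q).val = n - 1}

lemma Rc.step {S : Set (Fin n)} {B : Fin n → Fin n} (h : Rc m n hm hn S) (hB : Fx m n hm hn B) :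
    Rc m n hm hn {q | B q ∈ S} := by
  obtain ⟨B', h', rfl⟩ := h
  exact ⟨_, h'.comp hB, rfl⟩

lemma Rc.fill (h3 : 3 ≤ m) (hn3 : 3 ≤ n) (E : Set (Fin n)) (hE : ∀ q ∈ E, q.val = 1)
    (z : Fin n) (hz : z.val ≠ 1) (h : Rc m n hm hn (insert z E)) (F : Finset (Fin n))
    (hF : ∀ q ∈ F, q.val ≠ 1) : Rc m n hm hn (E ∪ ↑F) := by
  have hR := h
  clear h
  have hsing : ∀ x : Fin n, x.val ≠ 1 → Rc m n hm hn (insert x E) := by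
    intro x hx
    have := hR.step (Iso.fx (Sw.all h3 hn3 z x hz hx))
    convert this using 1
    ext q
    simp only [Set.mem_insert_iff, Set.mem_ofPred_eq]
    rw [Equiv.swap_apply_def]
    have h1 : q ∈ E → q ≠ x := by rintro h rfl; exact hx (hE _ h)
    have h2 : q ∈ E → q ≠ z := by rintro h rfl; exact hz (hE _ h)
    have h3 : z ∉ E := fun h => hz (hE _ h)
    have h4 : x ∉ E := fun h => hx (hE _ h)
    split_ifs <;> grind
  induction F using Finset.induction_on with
  | empty =>
    have h0 := hsing ⟨0, hn⟩ (by simp)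
    have := h0.step (Cp.all h3 hn3 ⟨2, by omega⟩ ⟨0, hn⟩ (by simp) (by simp) (by simp))
    convert this using 1
    ext q
    simp only [Finset.coe_empty, Set.union_empty, Set.mem_insert_iff, Set.mem_ofPred_eq]
    have h3 : (⟨0, hn⟩ : Fin n) ∉ E := fun h => absurd (hE _ h) (by simp)
    have h4 : (⟨2, by omega⟩ : Fin n) ∉ E := fun h => absurd (hE _ h) (by simp)
    have h5 : (⟨2, by omega⟩ : Fin n) ≠ ⟨0, hn⟩ := by simp
    split_ifs <;> grind
  | insert y F hy ih =>
    have ih := ih (fun q hq => hF q (Finset.mem_insert_of_mem hq))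
    have hy1 := hF y (Finset.mem_insert_self _ _)
    rcases F.eq_empty_or_nonempty with rfl | ⟨x, hx⟩
    · convert hsing y hy1 using 1
      ext q; simp
    · have hxy : x ≠ y := by rintro rfl; exact hy hx
      have := ih.step (Cp.all h3 hn3 x y (hF x (Finset.mem_insert_of_mem hx)) hy1 hxy)
      convert this using 1
      ext q
      simp only [Finset.coe_insert, Set.mem_union, Set.mem_insert_iff, Set.mem_ofPred_eq,
        Finset.mem_coe]
      split_ifs <;> grind

lemma Rc.zero (h3 : 3 ≤ m) (hn3 : 3 ≤ n) (F : Finset (Fin n))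
    (hF : ∀ q ∈ F, q.val ≠ 1) : Rc m n hm hn (↑F) := by
  have := Rc.fill (hm := hm) (hn := hn) h3 hn3 ∅ (by simp) ⟨n-1, by omega⟩ (by simp; omega)
    ⟨fun q => q, ⟨_, Rl.id, rfl⟩, by ext q; simp [Fin.ext_iff]⟩ F hF
  simpa using this

end

lemma Rc.one {m n : ℕ} {hm : 0 < m} {hn : 0 < n} (h3 : 3 ≤ m) (hn3 : 3 ≤ n) :
    ∃ z : Fin n, z.val ≠ 1 ∧ Rc m n hm hn (insert z {⟨1, by omega⟩}) := by
  by_cases h4 : m = 3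
  · by_cases hn4 : n = 3
    · subst h4 hn4
      refine ⟨0, by simp, fun q => (Udfa 3 (by omega)).evalFrom q [1, 0, 2, 0, 2, 0, 0].reverse,
        ⟨fun t => (Udfa 3 (by omega)).evalFrom t [1, 0, 2, 0, 2, 0, 0],
          ⟨[1, 0, 2, 0, 2, 0, 0], fun t => rfl, fun t => rfl⟩, by clear * -; decide +revert⟩, ?_⟩
      ext q
      simp only [Set.mem_insert_iff, Set.mem_singleton_iff, Set.mem_ofPred_eq]
      clear * -
      revert q
      decide +revert
    · refine ⟨⟨0, hn⟩, by simp, ?_⟩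
      have h0 := Rc.zero (hm := hm) (hn := hn) h3 hn3
        {⟨3, by omega⟩, cyc n ⟨3, by omega⟩} (by
          intro q hq
          simp only [Finset.mem_insert, Finset.mem_singleton] at hq
          rcases hq with rfl | rfl
          · simp
          · rw [cyc_val]; simp only []; grind)
      have hf : Fx m n hm hn ((cyc n)^[3]) := ⟨_, Rl.ak 3, by
        subst h4; apply Fin.ext; rw [cyc_iter_val]; simp⟩
      convert h0.step hf using 1
      ext q
      have := q.isLt
      simp only [Set.mem_insert_iff, Set.mem_singleton_iff, Set.mem_ofPred_eq,
        Finset.coe_insert, Finset.coe_singleton, Function.iterate_succ_apply,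
        Function.iterate_zero_apply, Fin.ext_iff, cyc_val]
      grind
  · refine ⟨⟨2, by omega⟩, by simp, ?_⟩
    have h0 := Rc.zero (hm := hm) (hn := hn) h3 hn3 {⟨2, by omega⟩} (by simp)
    have hf : Fx m n hm hn (fun q => cyc n (cyc n (sing n (pc n (pc n q))))) :=
      ⟨_, Rl.a.comp (Rl.a.comp (Rl.c.comp (Rl.p.comp Rl.p))), by
        apply Fin.ext
        rw [pc_val, pc_val, sing_val, cyc_val, cyc_val]; simp only []; grind⟩
    convert h0.step hf using 1
    ext q
    have := q.isLt
    simp only [Set.mem_insert_iff, Set.mem_singleton_iff, Set.mem_ofPred_eq,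
        Finset.coe_singleton, Fin.ext_iff, cyc_val, sing_val, pc_val]
    grind

section
variable {m n : ℕ} {hm : 0 < m} {hn : 0 < n}

lemma Rc.all (h3 : 3 ≤ m) (hn3 : 3 ≤ n) (S : Set (Fin n)) : Rc m n hm hn S := by
  classical
  by_cases h1 : (⟨1, by omega⟩ : Fin n) ∈ S
  · obtain ⟨z, hz, h⟩ := Rc.one (hm := hm) (hn := hn) h3 hn3
    have := Rc.fill h3 hn3 _ (by simp) z hz h
      (Finset.univ.filter fun q => q ∈ S ∧ q.val ≠ 1) (by simp)
    convert this using 1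
    ext q
    simp only [Set.mem_union, Set.mem_singleton_iff, Finset.coe_filter, Finset.mem_univ, true_and,
      Set.mem_ofPred_eq]
    by_cases hq : q = ⟨1, by omega⟩
    · subst hq; simpa using h1
    · have : q.val ≠ 1 := fun h => hq (Fin.ext h)
      tauto
  · have := Rc.zero (hm := hm) (hn := hn) h3 hn3
      (Finset.univ.filter fun q => q ∈ S) (by
        intro q hq h
        simp only [Finset.mem_filter, Finset.mem_univ, true_and] at hq
        have : q = ⟨1, by omega⟩ := Fin.ext h
        exact h1 (this ▸ hq))
    simpa using this

lemma reach (h3 : 3 ≤ m) (hn3 : 3 ≤ n) (i : Fin m) (S : Set (Fin n)) :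
    ∃ w : List (Fin 3), (Udfa m hm).evalFrom ⟨0, hm⟩ w = i ∧
      {q | ((Udfa n hn).evalFrom q w.reverse).val = n - 1} = S := by
  obtain ⟨B, ⟨T, hR, hT⟩, e⟩ := Rc.all (hm := hm) (hn := hn) h3 hn3 {q | (pc n)^[i.val] q ∈ S}
  obtain ⟨w, h1, h2⟩ := hR.comp (Rl.ak i.val)
  refine ⟨w, ?_, ?_⟩
  · simp only [h1, hT]
    apply Fin.ext
    rw [cyc_iter_val]; simp [Nat.mod_eq_of_lt i.isLt]
  · ext q
    simp only [Set.mem_ofPred_eq, h2]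
    have := Set.ext_iff.1 e ((cyc n)^[i.val] q)
    simp only [Set.mem_ofPred_eq, pc_iter_cyc] at this
    exact this.symm

end

lemma sc_eq {α : Type} (L : Language α) (hf : (Set.range L.leftQuotient).Finite) :
    sc L = (Set.range L.leftQuotient).ncard := by
  apply le_antisymm
  · apply Nat.sInf_le
    have := hf.fintype
    let e : Set.range L.leftQuotient ≃ Fin (Set.range L.leftQuotient).ncard :=
      Finite.equivFinOfCardEq (Nat.card_coe_set_eq _)
    exact ⟨DFA.reindex e L.toDFA, by rw [DFA.accepts_reindex, Language.accepts_toDFA]⟩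
  · have hne : (complexitySet L).Nonempty := by
      have := hf.fintype
      let e : Set.range L.leftQuotient ≃ Fin (Set.range L.leftQuotient).ncard :=
        Finite.equivFinOfCardEq (Nat.card_coe_set_eq _)
      exact ⟨_, DFA.reindex e L.toDFA, by rw [DFA.accepts_reindex, Language.accepts_toDFA]⟩
    have hmem := Nat.sInf_mem hne
    change sc L ∈ _ at hmem
    generalize sc L = N at hmem ⊢
    obtain ⟨M, hM⟩ := hmem
    have hsub : Set.range L.leftQuotient ⊆ Set.range M.acceptsFrom := by
      rintro _ ⟨x, rfl⟩
      rw [← hM, Language.leftQuotient_accepts_apply]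
      exact ⟨_, rfl⟩
    calc (Set.range L.leftQuotient).ncard ≤ (Set.range M.acceptsFrom).ncard :=
          Set.ncard_le_ncard hsub (Set.finite_range _)
      _ ≤ (Set.univ : Set (Fin N)).ncard := by
          rw [← Set.image_univ]; exact Set.ncard_image_le
      _ = N := by simp

lemma main (m n : ℕ) (hm : 0 < m) (hn : 0 < n) (h3 : 3 ≤ m) (hn3 : 3 ≤ n)
    (f : Prop → Prop → Prop) (q₀ : Prop) (hc : ∀ p p', f p q₀ ↔ f p' q₀)
    (hnc : ¬ (f True (¬ q₀) ↔ f False (¬ q₀)))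
    (L : Language (Fin 3)) (hL : ∀ w, w ∈ L ↔ f (w ∈ U m hm) (w ∈ rev (U n hn))) :
    sc L = m * 2 ^ n - (m - 1) := by
  classical
  let g : Fin m × Set (Fin n) → Language (Fin 3) := fun p =>
    {v | f (((Udfa m hm).evalFrom p.1 v).val = m - 1) ((Udfa n hn).evalFrom ⟨0, hn⟩ v.reverse ∈ p.2)}
  let E : Set (Fin n) := {_q | q₀}
  let A : Set (Fin m × Set (Fin n)) := {p | ¬ (p.2 = E ∧ p.1 ≠ ⟨0, hm⟩)}
  have hq : ∀ w, L.leftQuotient w = g ((Udfa m hm).evalFrom ⟨0, hm⟩ w,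
      {q | ((Udfa n hn).evalFrom q w.reverse).val = n - 1}) := by
    intro w
    ext v
    rw [Language.mem_leftQuotient, hL]
    have h1 : w ++ v ∈ U m hm ↔
        ((Udfa m hm).evalFrom ((Udfa m hm).evalFrom ⟨0, hm⟩ w) v).val = m - 1 := by
      rw [← DFA.evalFrom_of_append]; rfl
    have h2 : w ++ v ∈ rev (U n hn) ↔ ((Udfa n hn).evalFrom
        ((Udfa n hn).evalFrom ⟨0, hn⟩ v.reverse) w.reverse).val = n - 1 := by
      rw [← DFA.evalFrom_of_append, ← List.reverse_append]; rfl
    rw [h1, h2]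
    rfl
  have hrange : Set.range L.leftQuotient = Set.range g := by
    ext K
    constructor
    · rintro ⟨w, rfl⟩; exact ⟨_, (hq w).symm⟩
    · rintro ⟨⟨i, S⟩, rfl⟩
      obtain ⟨w, h1, h2⟩ := reach (hm := hm) (hn := hn) h3 hn3 i S
      exact ⟨w, by rw [hq, h1, h2]⟩
  have hE : ∀ i j, g (i, E) = g (j, E) := by
    intro i j
    ext v
    exact hc _ _
  have hA : Set.range g = g '' A := by
    ext K
    constructor
    · rintro ⟨⟨i, S⟩, rfl⟩
      by_cases h : S = E
      · subst h; exact ⟨(⟨0, hm⟩, E), by simp [A], hE _ _⟩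
      · exact ⟨(i, S), by simp [A, h], rfl⟩
    · rintro ⟨p, _, rfl⟩; exact ⟨p, rfl⟩
  have hinj : Set.InjOn g A := by
    rintro ⟨i, S⟩ hS ⟨j, S'⟩ hS' h
    have H : ∀ i₀ k, f (i = i₀) (k ∈ S) ↔ f (j = i₀) (k ∈ S') := by
      intro i₀ k
      obtain ⟨w, h1, h2⟩ := key (hm := hm) (hn := hn) h3 hn3 i₀ k
      have : w ∈ g (i, S) ↔ w ∈ g (j, S') := by rw [h]
      change f (((Udfa m hm).evalFrom i w).val = m - 1)
        ((Udfa n hn).evalFrom ⟨0, hn⟩ w.reverse ∈ S) ↔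
        f (((Udfa m hm).evalFrom j w).val = m - 1)
        ((Udfa n hn).evalFrom ⟨0, hn⟩ w.reverse ∈ S') at this
      rwa [h1, h1, h2] at this
    have hex : ∀ i : Fin m, ∃ i', i ≠ i' := by
      intro i
      refine ⟨cyc m i, fun h => ?_⟩
      have := congrArg Fin.val h
      rw [cyc_val] at this
      split_ifs at this <;> omega
    have aux : ∀ (i j : Fin m) (S S' : Set (Fin n)),
        (∀ i₀ k, f (i = i₀) (k ∈ S) ↔ f (j = i₀) (k ∈ S')) →
        ∀ k, (k ∈ S') = q₀ → (k ∈ S) = q₀ := by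
      intro i j S S' H k hk
      by_contra hne
      have hne : (k ∈ S) = ¬ q₀ := by
        by_cases h1 : k ∈ S <;> by_cases h2 : q₀ <;> simp_all
      obtain ⟨i', hi'⟩ := hex i
      have a1 := H i k
      have a2 := H i' k
      rw [hk, hne] at a1 a2
      rw [eq_self] at a1
      rw [eq_false hi'] at a2
      exact hnc (a1.trans ((hc _ _).trans a2.symm))
    have hSS : S = S' := by
      ext k
      have b1 := aux i j S S' H k
      have b2 := aux j i S' S (fun a b => (H a b).symm) k
      by_cases h1 : k ∈ S <;> by_cases h2 : k ∈ S' <;> by_cases h3 : q₀ <;> simp_all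
    subst hSS
    by_cases hSE : S = E
    · have h1 : i = ⟨0, hm⟩ := by
        by_contra h; exact hS ⟨hSE, h⟩
      have h2 : j = ⟨0, hm⟩ := by
        by_contra h; exact hS' ⟨hSE, h⟩
      rw [h1, h2]
    · have : ∃ k, (k ∈ S) = ¬ q₀ := by
        by_contra hcon
        push Not at hcon
        apply hSE
        ext k
        have := hcon k
        change k ∈ S ↔ q₀
        by_cases h1 : k ∈ S <;> by_cases h2 : q₀ <;> simp_all
      obtain ⟨k, hk⟩ := this
      by_contra hne
      have hij : ¬ j = i := fun h => hne (by rw [h])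
      have := H i k
      rw [hk, eq_self, eq_false hij] at this
      exact hnc this
  have hfin : (Set.range L.leftQuotient).Finite := by rw [hrange]; exact Set.finite_range _
  rw [sc_eq L hfin, hrange, hA, hinj.ncard_image]
  have hAc : Aᶜ.ncard = m - 1 := by
    have : Aᶜ = (fun i => (i, E)) '' ({⟨0, hm⟩}ᶜ : Set (Fin m)) := by
      ext ⟨i, S⟩
      simp only [A, Set.mem_compl_iff, Set.mem_ofPred_eq, not_not, Set.mem_image,
        Set.mem_singleton_iff, Prod.mk.injEq]
      constructor
      · rintro ⟨h1, h2⟩; exact ⟨i, h2, rfl, h1.symm⟩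
      · rintro ⟨x, h2, rfl, h1⟩; exact ⟨h1.symm, h2⟩
    rw [this, Set.ncard_image_of_injective _ (fun x y h => (Prod.mk.inj h).1), Set.ncard_compl]
    simp
  have := Set.ncard_add_ncard_compl A
  rw [hAc] at this
  have hcard : Nat.card (Fin m × Set (Fin n)) = m * 2 ^ n := by
    simp
  omega

end SCAux

theorem boolean_one_reversed_tight (m n : ℕ) (hm : 3 ≤ m) (hn : 3 ≤ n) :
    sc (lunion (U m (by omega)) (rev (U n (by omega)))) = m * 2 ^ n - (m - 1) ∧
    sc (linter (U m (by omega)) (rev (U n (by omega)))) = m * 2 ^ n - (m - 1) ∧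
    sc (ldiff (U m (by omega)) (rev (U n (by omega)))) = m * 2 ^ n - (m - 1) ∧
    sc (ldiff (rev (U n (by omega))) (U m (by omega))) = m * 2 ^ n - (m - 1) := by 
  refine ⟨?_, ?_, ?_, ?_⟩
  · exact SCAux.main m n _ _ hm hn (fun p q => p ∨ q) True (by simp) (by simp) _ (fun w => Iff.rfl)
  · exact SCAux.main m n _ _ hm hn (fun p q => p ∧ q) False (by simp) (by simp) _ (fun w => Iff.rfl)
  · exact SCAux.main m n _ _ hm hn (fun p q => p ∧ ¬ q) True (by simp) (by simp) _ (fun w => Iff.rfl)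
  · exact SCAux.main m n _ _ hm hn (fun p q => q ∧ ¬ p) False (by simp) (by simp) _ (fun w => Iff.rfl)
end

section
/- For m, n ≥ 3, the state complexity of the product Uₘ(a,b,c)·(Uₙ(a,b,c))ᴿ is exactly (m−1)·2ⁿ + 2^{n−1} − (m−1). -/
open SCPaper


/-- One letter transition of U_k. -/
def dl (k : ℕ) (h : 0 < k) (x : Fin 3) (i : Fin k) : Fin k := (Udfa k h).step i x

def PD (m n : ℕ) (hm : 0 < m) (hn : 0 < n) : DFA (Fin 3) (Fin m × Set (Fin n)) where
  step := fun s x => (dl m hm x s.1,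
    {i | dl n hn x i ∈ s.2 ∨ ((dl m hm x s.1).val = m - 1 ∧ i.val = n - 1)})
  start := (⟨0, hm⟩, ∅)
  accept := {s | (⟨0, hn⟩ : Fin n) ∈ s.2}

theorem PD_fst (m n : ℕ) (hm : 0 < m) (hn : 0 < n) (s : Fin m × Set (Fin n)) (w : List (Fin 3)) :
    ((PD m n hm hn).evalFrom s w).1 = (Udfa m hm).evalFrom s.1 w := by
  induction w using List.reverseRecOn with
  | nil => simp
  | append_singleton w x ih =>
    rw [DFA.evalFrom_append_singleton, DFA.evalFrom_append_singleton, ← ih]; rfl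

theorem PD_snd (m n : ℕ) (hm : 0 < m) (hn : 0 < n) (s : Fin m × Set (Fin n)) (w : List (Fin 3)) :
    ∀ j, j ∈ ((PD m n hm hn).evalFrom s w).2 ↔ ((Udfa n hn).evalFrom j w.reverse ∈ s.2 ∨
      ∃ u v, u ≠ [] ∧ u ++ v = w ∧ ((Udfa m hm).evalFrom s.1 u).val = m - 1 ∧
        ((Udfa n hn).evalFrom j v.reverse).val = n - 1) := by
  induction w using List.reverseRecOn with
  | nil => intro j; simp
  | append_singleton w x ih =>
    intro j
    rw [DFA.evalFrom_append_singleton]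
    have h1 : j ∈ ((PD m n hm hn).step ((PD m n hm hn).evalFrom s w) x).2 ↔
      ((dl n hn x j) ∈ ((PD m n hm hn).evalFrom s w).2 ∨
        (((Udfa m hm).evalFrom s.1 (w ++ [x])).val = m - 1 ∧ j.val = n - 1)) := by
      rw [DFA.evalFrom_append_singleton, ← PD_fst m n hm hn]; rfl
    rw [h1, ih]
    have h2 : (Udfa n hn).evalFrom j (w ++ [x]).reverse
        = (Udfa n hn).evalFrom (dl n hn x j) w.reverse := by
      simp [dl, DFA.evalFrom]
    rw [h2, or_assoc]
    apply or_congr_right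
    constructor
    · rintro (⟨u, v, hu, rfl, h3, h4⟩ | ⟨h3, h4⟩)
      · refine ⟨u, v ++ [x], hu, by simp, h3, ?_⟩
        simpa [dl, DFA.evalFrom] using h4
      · exact ⟨w ++ [x], [], by simp, by simp, h3, by simpa using h4⟩
    · rintro ⟨u, v, hu, h3, h4, h5⟩
      rcases List.eq_nil_or_concat v with rfl | ⟨v', y, rfl⟩
      · right
        simp at h3 h5
        subst h3
        exact ⟨h4, h5⟩
      · left
        rw [List.concat_eq_append, ← List.append_assoc] at h3
        obtain ⟨h6, h7⟩ := List.append_inj' h3 rfl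
        simp at h7
        subst h7
        refine ⟨u, v', hu, h6, h4, ?_⟩
        simpa [dl, DFA.evalFrom] using h5

theorem PD_accepts (m n : ℕ) (hm : 0 < m) (hn : 0 < n) (h2 : 2 ≤ m) :
    (PD m n hm hn).accepts = U m hm * rev (U n hn) := by
  ext w
  rw [DFA.mem_accepts, Language.mem_mul]
  have := PD_snd m n hm hn (⟨0, hm⟩, ∅) w ⟨0, hn⟩
  refine Iff.trans this ?_
  simp only [Set.mem_empty_iff_false, false_or]
  constructor
  · rintro ⟨u, v, hu, h3, h4, h5⟩
    exact ⟨u, h4, v, h5, h3⟩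
  · rintro ⟨u, h4, v, h5, h3⟩
    refine ⟨u, v, ?_, h3, h4, h5⟩
    rintro rfl
    have : (0 : ℕ) = m - 1 := h4
    omega

/-- sc as number of quotients -/
theorem sc_eq {α : Type} (L : Language α) (hf : (Set.range L.leftQuotient).Finite) :
    sc L = (Set.range L.leftQuotient).ncard := by
  apply le_antisymm
  · apply Nat.sInf_le
    have := hf.to_subtype
    have e : Set.range L.leftQuotient ≃ Fin (Set.range L.leftQuotient).ncard :=
      Finite.equivFin _
    exact ⟨DFA.reindex e L.toDFA, by simp⟩
  · apply le_csInf
    · have := hf.to_subtype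
      have e : Set.range L.leftQuotient ≃ Fin (Set.range L.leftQuotient).ncard :=
        Finite.equivFin _
      exact ⟨_, DFA.reindex e L.toDFA, by simp⟩
    · rintro k ⟨M, rfl⟩
      rw [Language.leftQuotient_accepts]
      refine (Set.ncard_le_ncard (Set.range_comp_subset_range M.eval M.acceptsFrom)
        (Set.toFinite _)).trans ?_
      rw [← Set.image_univ]
      refine (Set.ncard_image_le (Set.toFinite _)).trans ?_
      simp [Set.ncard_univ]

theorem R0_card (m n : ℕ) (hm : 2 ≤ m) (hn : 1 ≤ n) :
    {s : Fin m × Set (Fin n) | (s.1.val = m - 1 → (⟨n - 1, by omega⟩ : Fin n) ∈ s.2) ∧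
      (s.2 = Set.univ → s.1.val = 0)}.ncard = (m - 1) * 2 ^ n + 2 ^ (n - 1) - (m - 1) := by
  set a : Fin n := ⟨n - 1, by omega⟩
  set A : Set (Fin m × Set (Fin n)) := Prod.mk (⟨m - 1, by omega⟩ : Fin m) '' (𝒫 {a}ᶜ)
  set B : Set (Fin m × Set (Fin n)) :=
    (fun q => (q, (Set.univ : Set (Fin n)))) '' ({⟨0, by omega⟩}ᶜ : Set (Fin m))
  have hA : A.ncard = 2 ^ (n - 1) := by
    rw [Set.ncard_image_of_injective _ (Prod.mk_right_injective _), Set.ncard_powerset _ (Set.toFinite _),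
      Set.ncard_compl]
    simp
  have hB : B.ncard = m - 1 := by
    rw [Set.ncard_image_of_injective _ (Prod.mk_left_injective _), Set.ncard_compl]
    simp
  have hd : Disjoint A B := by
    rw [Set.disjoint_left]
    rintro _ ⟨S, hS, rfl⟩ ⟨q, hq, h⟩
    simp only [Prod.mk.injEq] at h
    rw [← h.2] at hS
    exact hS (Set.mem_univ a) rfl
  have : {s : Fin m × Set (Fin n) | (s.1.val = m - 1 → a ∈ s.2) ∧
      (s.2 = Set.univ → s.1.val = 0)} = (A ∪ B)ᶜ := by
    ext ⟨q, S⟩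
    simp only [Set.mem_ofPred_eq, Set.mem_compl_iff, Set.mem_union, not_or]
    apply and_congr
    · simp only [A, Set.mem_image, Prod.mk.injEq, Set.mem_powerset_iff, Set.subset_compl_singleton_iff]
      constructor
      · rintro h ⟨T, hT, h1, rfl⟩
        exact hT (h (by rw [← h1]))
      · intro h h1
        by_contra h2
        exact h ⟨S, h2, Fin.ext h1.symm, rfl⟩
    · simp only [B, Set.mem_image, Prod.mk.injEq, Set.mem_compl_iff, Set.mem_singleton_iff]
      constructor
      · rintro h ⟨T, hT, rfl, h1⟩
        exact hT (Fin.ext (h h1.symm))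
      · intro h h1
        by_contra h2
        exact h ⟨q, fun h3 => h2 (by rw [h3]), rfl, h1.symm⟩
  rw [this, Set.ncard_compl, Set.ncard_union_eq hd, hA, hB]
  simp only [Nat.card_eq_fintype_card, Fintype.card_prod, Fintype.card_fin, Fintype.card_set]
  obtain ⟨n, rfl⟩ : ∃ k, n = k + 1 := ⟨n - 1, by omega⟩
  obtain ⟨m, rfl⟩ : ∃ k, m = k + 1 := ⟨m - 1, by omega⟩
  simp only [Nat.add_sub_cancel, pow_succ, add_mul]
  omega

theorem lang_step {m n : ℕ} {hm : 0 < m} {hn : 0 < n} {s t : Fin m × Set (Fin n)}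
    (h : (PD m n hm hn).acceptsFrom s = (PD m n hm hn).acceptsFrom t) (x : Fin 3) :
    (PD m n hm hn).acceptsFrom ((PD m n hm hn).step s x) =
      (PD m n hm hn).acceptsFrom ((PD m n hm hn).step t x) := by
  ext w
  have : (x :: w) ∈ (PD m n hm hn).acceptsFrom s ↔ (x :: w) ∈ (PD m n hm hn).acceptsFrom t := by
    rw [h]
  exact this

theorem mem_iff_lang {m n : ℕ} {hm : 0 < m} {hn : 0 < n} (i : ℕ) :
    ∀ (s : Fin m × Set (Fin n)) (hi : i < n), ((⟨i, hi⟩ : Fin n) ∈ s.2 ↔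
      List.replicate i (0 : Fin 3) ∈ (PD m n hm hn).acceptsFrom s) := by
  induction i with
  | zero => intro s hi; rfl
  | succ i ih =>
    intro s hi
    rw [List.replicate_succ]
    refine Iff.trans ?_ (ih ((PD m n hm hn).step s 0) (by omega))
    have h1 : dl n hn 0 ⟨i, by omega⟩ = ⟨i + 1, hi⟩ := by
      apply Fin.ext
      simp [dl, Udfa, cyc, Nat.mod_eq_of_lt hi]
    change _ ↔ (dl n hn 0 ⟨i, by omega⟩ ∈ s.2 ∨ (_ ∧ i = n - 1))
    rw [h1]
    constructor
    · exact Or.inl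
    · rintro (h | ⟨_, h⟩)
      · exact h
      · omega

theorem lang_snd {m n : ℕ} {hm : 0 < m} {hn : 0 < n} {s t : Fin m × Set (Fin n)}
    (h : (PD m n hm hn).acceptsFrom s = (PD m n hm hn).acceptsFrom t) : s.2 = t.2 := by
  ext ⟨i, hi⟩
  rw [mem_iff_lang (hm := hm) (hn := hn), mem_iff_lang (hm := hm) (hn := hn), h]

theorem lang_univ {m n : ℕ} {hm : 0 < m} {hn : 0 < n} (q q' : Fin m) :
    (PD m n hm hn).acceptsFrom (q, Set.univ) = (PD m n hm hn).acceptsFrom (q', Set.univ) := by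
  have h : ∀ q : Fin m, ∀ w, w ∈ (PD m n hm hn).acceptsFrom (q, Set.univ) := fun q w =>
    (PD_snd m n hm hn (q, Set.univ) w ⟨0, hn⟩).2 (Or.inl (Set.mem_univ _))
  ext w
  exact ⟨fun _ => h _ _, fun _ => h _ _⟩

def Win (m n : ℕ) (hm : 0 < m) (hn : 0 < n) (q q' : Fin m) (p : Fin n) : Prop :=
  q ≠ q' ∧ ∀ S : Set (Fin n), p ∉ S →
    (q.val = m - 1 ∨ q'.val = m - 1 → (⟨n - 1, by omega⟩ : Fin n) ∈ S) →
    (PD m n hm hn).acceptsFrom (q, S) ≠ (PD m n hm hn).acceptsFrom (q', S)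

theorem Win.step {m n : ℕ} {hm : 0 < m} {hn : 0 < n} {q q' : Fin m} {p p' : Fin n} (x : Fin 3)
    (h : Win m n hm hn (dl m hm x q) (dl m hm x q') p') (hp : dl n hn x p' = p) :
    Win m n hm hn q q' p := by
  obtain ⟨h1, h2⟩ := h
  refine ⟨fun h => h1 (by rw [h]), ?_⟩
  intro S hpS _ heq
  have h3 := lang_step heq x
  have h4 := lang_snd h3
  have key : ((PD m n hm hn).step (q', S) x) =
    (dl m hm x q', ((PD m n hm hn).step (q, S) x).2) := by rw [h4]; rfl
  rw [key] at h3
  refine h2 ((PD m n hm hn).step (q, S) x).2 ?_ ?_ h3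
  · intro hc
    have hc' := hc
    rw [h4] at hc'
    rcases hc with hc | ⟨hc, h5⟩
    · rw [hp] at hc; exact hpS hc
    rcases hc' with hc' | ⟨hc', h5⟩
    · rw [hp] at hc'; exact hpS hc'
    exact h1 (Fin.ext (hc.trans hc'.symm))
  · rintro (hc | hc)
    · exact Or.inr ⟨hc, rfl⟩
    · rw [h4]; exact Or.inr ⟨hc, rfl⟩

/-- natural number indexed version -/
def W (m n : ℕ) (hm : 0 < m) (hn : 0 < n) (x y z : ℕ) : Prop :=
  Win m n hm hn ⟨x % m, Nat.mod_lt _ hm⟩ ⟨y % m, Nat.mod_lt _ hm⟩ ⟨z % n, Nat.mod_lt _ hn⟩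

theorem W.congr {m n : ℕ} {hm : 0 < m} {hn : 0 < n} {x y z x' y' z' : ℕ}
    (h : W m n hm hn x y z) (hx : x % m = x' % m) (hy : y % m = y' % m) (hz : z % n = z' % n) :
    W m n hm hn x' y' z' := by
  unfold W at *
  simpa only [hx, hy, hz] using h

theorem W.base {m n : ℕ} {hm : 0 < m} {hn : 0 < n} {x y z : ℕ}
    (hxy : x % m ≠ y % m) (hx : x % m = m - 1 ∨ y % m = m - 1) (hz : z % n = n - 1) :
    W m n hm hn x y z := by
  refine ⟨fun h => hxy (Fin.ext_iff.1 h), fun S hS hv => ?_⟩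
  refine absurd (hv hx) ?_
  simpa only [hz] using hS

theorem dl0 (k : ℕ) (h : 0 < k) (x : ℕ) :
    dl k h 0 ⟨x % k, Nat.mod_lt _ h⟩ = ⟨(x + 1) % k, Nat.mod_lt _ h⟩ := by
  apply Fin.ext
  simp [dl, Udfa, cyc]

theorem W.a {m n : ℕ} {hm : 0 < m} {hn : 0 < n} (k : ℕ) : ∀ {x y z : ℕ},
    W m n hm hn (x + k) (y + k) z → W m n hm hn x y (z + k) := by
  induction k with
  | zero => intro x y z h; exact h
  | succ k ih =>
    intro x y z h
    have h1 : W m n hm hn (x + 1) (y + 1) (z + k) := by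
      apply ih
      convert h using 1 <;> omega
    refine Win.step (p' := ⟨(z + k) % n, Nat.mod_lt _ hn⟩) 0 ?_ (dl0 n hn _)
    rw [dl0, dl0]
    exact h1

def sw (x : ℕ) : ℕ := if x = 0 then 1 else if x = 1 then 0 else x

theorem sw_lt {k x : ℕ} (hk : 2 ≤ k) (h : x < k) : sw x < k := by
  unfold sw; split_ifs <;> omega

theorem dl1 (k : ℕ) (h : 0 < k) (hk : 2 ≤ k) (x : ℕ) (hx : x < k) :
    dl k h 1 ⟨x, hx⟩ = ⟨sw x, sw_lt hk hx⟩ := by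
  apply Fin.ext
  have : 1 % k = 1 := Nat.mod_eq_of_lt hk
  simp only [dl, Udfa, tp01, sw]
  simp only [this]
  split_ifs <;> simp_all

theorem dl2 (k : ℕ) (h : 0 < k) (x : ℕ) (hx : x < k) :
    dl k h 2 ⟨x, hx⟩ = ⟨if x = k - 1 then 0 else x, by split_ifs <;> omega⟩ := by
  apply Fin.ext
  simp only [dl, Udfa, sing]
  norm_num
  split_ifs <;> simp_all

theorem W.b {m n : ℕ} {hm : 0 < m} {hn : 0 < n} (hm2 : 2 ≤ m) (hn2 : 2 ≤ n) {x y z : ℕ}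
    (hx : x < m) (hy : y < m) (hz : z < n) (h : W m n hm hn (sw x) (sw y) (sw z)) :
    W m n hm hn x y z := by
  unfold W at *
  simp only [Nat.mod_eq_of_lt hx, Nat.mod_eq_of_lt hy, Nat.mod_eq_of_lt hz,
    Nat.mod_eq_of_lt (sw_lt hm2 hx), Nat.mod_eq_of_lt (sw_lt hm2 hy),
    Nat.mod_eq_of_lt (sw_lt hn2 hz)] at *
  refine Win.step (p' := ⟨sw z, sw_lt hn2 hz⟩) 1 ?_ ?_
  · rw [dl1 _ _ hm2, dl1 _ _ hm2]; exact h
  · rw [dl1 _ _ hn2]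
    apply Fin.ext
    change sw (sw z) = z
    by_cases h0 : z = 0
    · simp [sw, h0]
    · by_cases h1 : z = 1 <;> simp [sw, h0, h1]

theorem W.c {m n : ℕ} {hm : 0 < m} {hn : 0 < n} {y z : ℕ}
    (hy : y < m - 1) (hz : z < n - 1) (h : W m n hm hn 0 y z) :
    W m n hm hn (m - 1) y z := by
  have e1 : (m - 1) % m = m - 1 := Nat.mod_eq_of_lt (by omega)
  have e2 : y % m = y := Nat.mod_eq_of_lt (by omega)
  have e3 : z % n = z := Nat.mod_eq_of_lt (by omega)
  unfold W at *
  simp only [e1, e2, e3, Nat.zero_mod] at *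
  refine Win.step (p' := ⟨z, by omega⟩) 2 ?_ ?_
  · rw [dl2, dl2]
    simpa [Nat.ne_of_lt hy] using h
  · rw [dl2]
    simp [Nat.ne_of_lt hz]

/-- `ab` word at position zero -/
theorem W.ab {m n : ℕ} {hm : 0 < m} {hn : 0 < n} (hm3 : 3 ≤ m) (hn3 : 3 ≤ n) {d z : ℕ}
    (hd : d < m) (hz : z < n)
    (h : W m n hm hn 0 (sw ((d + 1) % m)) (sw z)) : W m n hm hn 0 d (z + 1) := by
  apply W.a 1
  have := W.b (hm := hm) (hn := hn) (x := 1) (y := (d + 1) % m) (z := z) (by omega) (by omega) (by omega)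
    (Nat.mod_lt _ hm) hz (by simpa [sw] using h)
  exact this.congr (by simp) (by simp) rfl

def VW (m n : ℕ) (hm : 0 < m) (hn : 0 < n) (z : ℕ) : Prop :=
  ∀ d, 1 ≤ d → d < m → W m n hm hn 0 d z

theorem tau_ok {m d : ℕ} (hm3 : 3 ≤ m) (h1 : 1 ≤ d) (h2 : d < m) :
    1 ≤ sw ((d + 1) % m) ∧ sw ((d + 1) % m) < m := by
  refine ⟨?_, sw_lt (by omega) (Nat.mod_lt _ (by omega))⟩
  rcases Nat.lt_or_ge (d + 1) m with h | h
  · rw [Nat.mod_eq_of_lt h]; simp only [sw]; split_ifs <;> omega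
  · have : d + 1 = m := by omega
    rw [this, Nat.mod_self]; simp [sw]

theorem VW.ab {m n : ℕ} {hm : 0 < m} {hn : 0 < n} (hm3 : 3 ≤ m) (hn3 : 3 ≤ n) {z : ℕ}
    (hz : z < n) (h : VW m n hm hn (sw z)) : VW m n hm hn (z + 1) := fun d h1 h2 =>
  W.ab hm3 hn3 h2 hz (h _ (tau_ok hm3 h1 h2).1 (tau_ok hm3 h1 h2).2)

theorem VW.congr {m n : ℕ} {hm : 0 < m} {hn : 0 < n} {z z' : ℕ}
    (h : VW m n hm hn z) (hz : z % n = z' % n) : VW m n hm hn z' := fun d h1 h2 =>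
  (h d h1 h2).congr rfl rfl hz

theorem VW.up {m n : ℕ} {hm : 0 < m} {hn : 0 < n} (hm3 : 3 ≤ m) (hn3 : 3 ≤ n) {z : ℕ} (k : ℕ)
    (h2 : 2 ≤ z) (hz : z + k < n) (h : VW m n hm hn z) : VW m n hm hn (z + k) := by
  induction k with
  | zero => exact h
  | succ k ih =>
    have := ih (by omega)
    apply VW.ab (z := z + k) hm3 hn3 (by omega)
    have e : sw (z + k) = z + k := by unfold sw; split_ifs <;> omega
    rwa [e]

theorem VW.all {m n : ℕ} {hm : 0 < m} {hn : 0 < n} (hm3 : 3 ≤ m) (hn3 : 3 ≤ n) {s : ℕ}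
    (hs : s < n) (hs1 : s ≠ 1) (h : VW m n hm hn s) (p : ℕ) (hp : p < n) (hp1 : p ≠ 1) :
    VW m n hm hn p := by
  have h02 : VW m n hm hn 0 → VW m n hm hn 2 := fun h =>
    VW.ab (z := 1) hm3 hn3 (by omega) (by simpa [sw] using h)
  have hl0 : VW m n hm hn (n - 1) → VW m n hm hn 0 := fun h => by
    refine VW.congr (VW.ab (z := n - 1) hm3 hn3 (by omega) ?_) (z' := 0) ?_
    · have e : sw (n - 1) = n - 1 := by unfold sw; split_ifs <;> omega
      rwa [e]
    · rw [Nat.sub_add_cancel (by omega)]; simp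
  have h2 : VW m n hm hn 2 := by
    by_cases h0 : s = 0
    · subst h0; exact h02 h
    · apply h02
      apply hl0
      have := VW.up hm3 hn3 (n - 1 - s) (by omega) (by omega) h
      rwa [show s + (n - 1 - s) = n - 1 by omega] at this
  by_cases h0 : p = 0
  · subst h0
    apply hl0
    have := VW.up hm3 hn3 (n - 1 - 2) (by omega) (by omega) h2
    rwa [show 2 + (n - 1 - 2) = n - 1 by omega] at this
  · have := VW.up hm3 hn3 (p - 2) (by omega) (by omega) h2
    rwa [show 2 + (p - 2) = p by omega] at this

theorem VW.ne1 {m n : ℕ} {hm : 0 < m} {hn : 0 < n} (hm3 : 3 ≤ m) (hn3 : 3 ≤ n)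
    (p : ℕ) (hp : p < n) (hp1 : p ≠ 1) : VW m n hm hn p := by
  have hbase : ∀ d, 1 ≤ d → d < m → ∀ k, (m - 1 + k * m) % m ≠ (d + (m - 1 + k * m)) % m ∧
      (m - 1 + k * m) % m = m - 1 := by
    intro d h1 h2 k
    have e : d + (m - 1 + k * m) = (d - 1) + (k + 1) * m := by rw [add_mul]; omega
    rw [e, Nat.add_mul_mod_self_right, Nat.add_mul_mod_self_right, Nat.mod_eq_of_lt (by omega),
      Nat.mod_eq_of_lt (by omega)]
    omega
  by_cases hc : (m - 2) % n = 1
  · rcases Nat.lt_or_ge 3 n with h4 | h4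
    · -- two laps
      have h41 : 4 % n ≠ 1 := by
        rcases Nat.lt_or_ge 4 n with h | h
        · rw [Nat.mod_eq_of_lt h]; omega
        · have : n = 4 := by omega
          subst this; norm_num
      refine VW.all hm3 hn3 (Nat.mod_lt _ hn) h41 ?_ p hp hp1
      intro d h1 h2
      have hb := hbase d h1 h2 1
      have : W m n hm hn (0 + (m - 1 + 1 * m)) (d + (m - 1 + 1 * m)) (n - 1) :=
        W.base (by simpa using hb.1) (Or.inl (by simpa using hb.2))
          (Nat.mod_eq_of_lt (by omega))
      refine (W.a _ this).congr rfl rfl ?_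
      rw [Nat.mod_mod]
      have e : n - 1 + (m - 1 + 1 * m) = n + 2 * (m - 2) + 2 := by omega
      rw [e]
      have e2 : (m - 2) ≡ 1 [MOD n] := by
        rw [Nat.ModEq, hc, Nat.mod_eq_of_lt (by omega)]
      have e3 : n + 2 * (m - 2) + 2 ≡ 0 + 2 * 1 + 2 [MOD n] :=
        ((Nat.ModEq.add (by simp [Nat.ModEq]) (e2.mul_left 2))).add_right 2
      exact e3
    · have : n = 3 := by omega
      subst this
      refine VW.all (s := 0) hm3 hn3 (by omega) (by omega) ?_ p hp hp1
      intro d h1 h2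
      by_cases hd : d = 1
      · subst hd
        have : W m 3 hm hn (0 + (m - 2)) (1 + (m - 2)) 2 := by
          have e1 : (0 + (m - 2)) % m = m - 2 := by rw [zero_add]; exact Nat.mod_eq_of_lt (by omega)
          have e2 : (1 + (m - 2)) % m = m - 1 := by
            rw [show 1 + (m - 2) = m - 1 by omega]; exact Nat.mod_eq_of_lt (by omega)
          refine W.base ?_ (Or.inr e2) rfl
          rw [e1, e2]; omega
        exact (W.a _ this).congr rfl rfl (by omega)
      · have e1 : (m - 1) % m = m - 1 := Nat.mod_eq_of_lt (by omega)
        have t1 : W m 3 hm hn (0 + (m - 1)) ((d - 1) + (m - 1)) 2 := by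
          have e2 : (d - 1 + (m - 1)) % m = d - 2 := by
            rw [show d - 1 + (m - 1) = d - 2 + m by omega, Nat.add_mod_right]
            exact Nat.mod_eq_of_lt (by omega)
          refine W.base ?_ (Or.inl ?_) rfl
          · rw [zero_add, e1, e2]; omega
          · rw [zero_add, e1]
        have t2 : W m 3 hm hn 0 (d - 1) 1 := (W.a _ t1).congr rfl rfl (by omega)
        have t3 : W m 3 hm hn (m - 1) (d - 1) 1 := W.c (by omega) (by omega) t2
        have t4 : W m 3 hm hn (0 + (m - 1)) (d + (m - 1)) 1 := by
          refine t3.congr (by simp) ?_ rfl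
          rw [show d + (m - 1) = d - 1 + m by omega, Nat.add_mod_right]
        exact (W.a _ t4).congr rfl rfl (by omega)
  · refine VW.all hm3 hn3 (Nat.mod_lt _ hn) hc ?_ p hp hp1
    intro d h1 h2
    have hb := hbase d h1 h2 0
    have : W m n hm hn (0 + (m - 1 + 0 * m)) (d + (m - 1 + 0 * m)) (n - 1) :=
      W.base (by simpa using hb.1) (Or.inl (by simpa using hb.2))
        (Nat.mod_eq_of_lt (by omega))
    refine (W.a _ this).congr rfl rfl ?_
    rw [Nat.mod_mod, show n - 1 + (m - 1 + 0 * m) = m - 2 + n by omega, Nat.add_mod_right]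

theorem VW.one {m n : ℕ} {hm : 0 < m} {hn : 0 < n} (hm3 : 3 ≤ m) (hn3 : 3 ≤ n) :
    VW m n hm hn 1 := by
  have main : ∀ d, 2 ≤ d → d < m → W m n hm hn 0 d 1 := by
    intro d h1 h2
    by_cases hc : m % n = 0
    · have e2 : (d + (m - 1)) % m = d - 1 := by
        rw [show d + (m - 1) = d - 1 + m by omega, Nat.add_mod_right]
        exact Nat.mod_eq_of_lt (by omega)
      have e1 : (m - 1) % m = m - 1 := Nat.mod_eq_of_lt (by omega)
      have hz : (2 + (m - 1)) % n = 1 % n := by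
        rw [show 2 + (m - 1) = 1 + m by omega, Nat.add_mod, hc]; simp
      have t : W m n hm hn (0 + (m - 1)) (d + (m - 1)) 2 := by
        rcases Nat.lt_or_ge 3 n with h4 | h4
        · have := W.c (hm := hm) (hn := hn) (y := d - 1) (z := 2) (by omega) (by omega)
            (VW.ne1 hm3 hn3 2 (by omega) (by omega) (d - 1) (by omega) (by omega))
          refine this.congr (by simp) ?_ rfl
          rw [e2]; exact Nat.mod_eq_of_lt (by omega)
        · refine W.base ?_ (Or.inl ?_) ?_
          · rw [zero_add, e1, e2]; omega
          · rw [zero_add, e1]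
          · rw [show n = 3 by omega]
      exact (W.a _ t).congr rfl rfl hz
    · have hlt := Nat.mod_lt m hn
      have hv := VW.ne1 (hm := hm) (hn := hn) hm3 hn3 ((n - m % n + 1) % n) (Nat.mod_lt _ hn) (by
        rcases Nat.lt_or_ge (n - m % n + 1) n with h | h
        · rw [Nat.mod_eq_of_lt h]; omega
        · rw [show n - m % n + 1 = n by omega]; simp)
      have t : W m n hm hn (0 + m) (d + m) (n - m % n + 1) :=
        (hv d (by omega) h2).congr (by simp) (by simp) (by simp)
      refine (W.a _ t).congr rfl rfl ?_
      have := Nat.div_add_mod m n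
      rw [show n - m % n + 1 + m = 1 + n * (m / n + 1) by rw [mul_add]; omega]
      simp
  intro d h1 h2
  by_cases hd : d = 1
  · subst hd
    apply W.ab (z := 0) hm3 hn3 h2 (by omega)
    have : (1 + 1) % m = 2 := Nat.mod_eq_of_lt (by omega)
    rw [this]
    exact main 2 (by omega) (by omega)
  · exact main d (by omega) h2

theorem Win.all {m n : ℕ} {hm : 0 < m} {hn : 0 < n} (hm3 : 3 ≤ m) (hn3 : 3 ≤ n)
    (q q' : Fin m) (p : Fin n) (hne : q ≠ q') : Win m n hm hn q q' p := by
  have hV : ∀ z, VW m n hm hn z := by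
    intro z
    have : VW m n hm hn (z % n) := by
      by_cases h : z % n = 1
      · rw [h]; exact VW.one hm3 hn3
      · exact VW.ne1 hm3 hn3 _ (Nat.mod_lt _ hn) h
    exact this.congr (by simp)
  have hne' : q.val ≠ q'.val := fun h => hne (Fin.ext h)
  obtain ⟨q, hq⟩ := q
  obtain ⟨q', hq'⟩ := q'
  obtain ⟨p, hp⟩ := p
  simp only at hne'
  have t : W m n hm hn (q + (m - q)) (q' + (m - q)) (p + (n - 1) * (m - q)) := by
    refine (hV (p + (n - 1) * (m - q)) ((q' + (m - q)) % m) ?_ (Nat.mod_lt _ hm)).congr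
      ?_ (by simp) rfl
    · rcases Nat.lt_or_ge q q' with h | h
      · rw [show q' + (m - q) = q' - q + m by omega, Nat.add_mod_right,
          Nat.mod_eq_of_lt (by omega)]
        omega
      · rw [Nat.mod_eq_of_lt (by omega)]; omega
    · rw [show q + (m - q) = m by omega]; simp
  have t2 : W m n hm hn q q' p := by
    refine (W.a _ t).congr rfl rfl ?_
    have : p + (n - 1) * (m - q) + (m - q) = p + n * (m - q) := by
      obtain ⟨k, rfl⟩ : ∃ k, n = k + 1 := ⟨n - 1, by omega⟩
      simp only [Nat.add_sub_cancel]; ring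
    rw [this]; simp
  unfold W at t2
  simpa only [Nat.mod_eq_of_lt hq, Nat.mod_eq_of_lt hq', Nat.mod_eq_of_lt hp] using t2

def sh (n : ℕ) (hn : 0 < n) (k : ℕ) (i : Fin n) : Fin n := ⟨(i.val + k) % n, Nat.mod_lt _ hn⟩

theorem sh_inj (n : ℕ) (hn : 0 < n) (k : ℕ) : Function.Injective (sh n hn k) := by
  intro i j h
  have h1 : (i.val + k) % n = (j.val + k) % n := Fin.ext_iff.1 h
  have h2 : i.val ≡ j.val [MOD n] := Nat.ModEq.add_right_cancel' k h1
  apply Fin.ext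
  exact Nat.ModEq.eq_of_lt_of_lt h2 i.isLt j.isLt

theorem sh_zero (n : ℕ) (hn : 0 < n) (i : Fin n) : sh n hn 0 i = i := by
  apply Fin.ext
  simp [sh, Nat.mod_eq_of_lt i.isLt]

theorem dl0_sh (n : ℕ) (hn : 0 < n) (i : Fin n) : dl n hn 0 i = sh n hn 1 i := rfl

theorem sh_dl0 (n : ℕ) (hn : 0 < n) (k : ℕ) (i : Fin n) :
    sh n hn k (dl n hn 0 i) = sh n hn (k + 1) i := by
  apply Fin.ext
  simp only [dl0_sh, sh, Nat.mod_add_mod]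
  congr 1; omega

def Rch (m n : ℕ) (hm : 0 < m) (hn : 0 < n) (s : Fin m × Set (Fin n)) : Prop :=
  ∃ w, (PD m n hm hn).eval w = s

theorem Rch.step {m n : ℕ} {hm : 0 < m} {hn : 0 < n} {q q' : Fin m} {S T : Set (Fin n)}
    (h : Rch m n hm hn (q, S)) (x : Fin 3) (hq : dl m hm x q = q')
    (hT : ∀ i, i ∈ T ↔ (dl n hn x i ∈ S ∨ (q'.val = m - 1 ∧ i.val = n - 1))) :
    Rch m n hm hn (q', T) := by
  obtain ⟨w, hw⟩ := h
  refine ⟨w ++ [x], ?_⟩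
  rw [DFA.eval_append_singleton, hw]
  subst hq
  refine Prod.ext rfl ?_
  ext i
  exact (hT i).symm

theorem Rch.a {m n : ℕ} {hm : 0 < m} {hn : 0 < n} {S : Set (Fin n)}
    (h : Rch m n hm hn (⟨0, hm⟩, S)) (k : ℕ) (hk : k < m - 1) :
    Rch m n hm hn (⟨k, by omega⟩, {i | sh n hn k i ∈ S}) := by
  induction k with
  | zero =>
    convert h using 2
    ext i
    simp [sh_zero]
  | succ k ih =>
    refine (ih (by omega)).step 0 ?_ ?_
    · apply Fin.ext
      simp only [dl0_sh, sh]
      exact Nat.mod_eq_of_lt (by omega)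
    · intro i
      change _ ↔ (sh n hn k (dl n hn 0 i) ∈ S ∨ (k + 1 = m - 1 ∧ _))
      rw [sh_dl0]
      have : ¬ (k + 1 = m - 1) := by omega
      simp [this]

theorem Rch.top {m n : ℕ} {hm : 0 < m} {hn : 0 < n} (hm2 : 2 ≤ m) {S : Set (Fin n)}
    (h : Rch m n hm hn (⟨0, hm⟩, S)) :
    Rch m n hm hn (⟨m - 1, by omega⟩, {i | sh n hn (m - 1) i ∈ S ∨ i.val = n - 1}) := by
  refine (h.a (m - 2) (by omega)).step 0 ?_ ?_
  · apply Fin.ext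
    simp only [dl0_sh, sh]
    rw [Nat.mod_eq_of_lt (by omega)]; omega
  · intro i
    change _ ↔ (sh n hn (m - 2) (dl n hn 0 i) ∈ S ∨ (m - 1 = m - 1 ∧ _))
    rw [sh_dl0, show m - 2 + 1 = m - 1 by omega]
    simp

def G (m n : ℕ) (hm : 0 < m) (hn : 0 < n) (S : Set (Fin n)) : Prop :=
  Rch m n hm hn (⟨0, hm⟩, S)

theorem dl2_top {m : ℕ} {hm : 0 < m} (hm2 : 2 ≤ m) : dl m hm 2 ⟨m - 1, by omega⟩ = ⟨0, hm⟩ := by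
  rw [dl2]; simp

section
variable {m n : ℕ} {hm : 0 < m} {hn : 0 < n}

theorem G.empty : G m n hm hn ∅ := ⟨[], rfl⟩

theorem G.lapA (hm2 : 2 ≤ m) (hn2 : 2 ≤ n) {S T : Set (Fin n)} (h : G m n hm hn S)
    (hT : ∀ i, i ∈ T ↔ (sh n hn m i ∈ S ∨ i.val = n - 2)) : G m n hm hn T := by
  refine (h.top hm2).step 0 ?_ ?_
  · apply Fin.ext
    simp only [dl0_sh, sh]
    rw [Nat.sub_add_cancel (by omega)]; simp
  · intro i
    rw [hT]
    change _ ↔ ((sh n hn (m - 1) (dl n hn 0 i) ∈ S ∨ (i.val + 1) % n = n - 1) ∨ (0 = m - 1 ∧ _))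
    rw [sh_dl0, Nat.sub_add_cancel (by omega)]
    have h0 : ¬ (0 = m - 1) := by omega
    have h1 : (i.val + 1) % n = n - 1 ↔ i.val = n - 2 := by
      rcases Nat.lt_or_ge (i.val + 1) n with h | h
      · rw [Nat.mod_eq_of_lt h]; omega
      · rw [show i.val + 1 = n by omega, Nat.mod_self]; omega
    rw [h1]; simp [h0]

theorem G.lapC (hm2 : 2 ≤ m) {S T : Set (Fin n)} (h : G m n hm hn S)
    (hT : ∀ i, i ∈ T ↔ (sh n hn (m - 1) (dl n hn 2 i) ∈ S ∨ (dl n hn 2 i).val = n - 1)) :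
    G m n hm hn T := by
  refine (h.top hm2).step 2 (dl2_top hm2) ?_
  intro i
  rw [hT]
  have h0 : ¬ (0 = m - 1) := by omega
  simp [h0]

theorem G.lapBC (hm3 : 3 ≤ m) (hn3 : 3 ≤ n) {S T : Set (Fin n)} (h : G m n hm hn S)
    (hT : ∀ i, i ∈ T ↔ (sh n hn (m - 1) (dl n hn 1 (dl n hn 2 i)) ∈ S ∨
      (dl n hn 2 i).val = n - 1)) :
    G m n hm hn T := by
  have h1 : Rch m n hm hn (⟨m - 1, by omega⟩,
      {i | sh n hn (m - 1) (dl n hn 1 i) ∈ S ∨ i.val = n - 1}) := by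
    refine (h.top (by omega)).step 1 ?_ ?_
    · rw [dl1 _ _ (by omega)]
      apply Fin.ext
      simp only [sw]
      split_ifs <;> omega
    · intro i
      have : (dl n hn 1 i).val = n - 1 ↔ i.val = n - 1 := by
        obtain ⟨i, hi⟩ := i
        rw [dl1 _ _ (by omega)]
        simp only [sw]
        split_ifs <;> omega
      simp [this]
  refine h1.step 2 (dl2_top (by omega)) ?_
  intro i
  rw [hT]
  have h0 : ¬ (0 = m - 1) := by omega
  simp [h0]

theorem G.ab (hm3 : 3 ≤ m) {S T : Set (Fin n)} (h : G m n hm hn S)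
    (hT : ∀ i, i ∈ T ↔ dl n hn 0 (dl n hn 1 i) ∈ S) : G m n hm hn T := by
  have h1 := h.a 1 (by omega)
  refine h1.step 1 ?_ ?_
  · rw [dl1 _ _ (by omega)]; rfl
  · intro i
    rw [hT]
    have h0 : ¬ (0 = m - 1) := by omega
    simp [h0, dl0_sh]

theorem G.c (hm3 : 3 ≤ m) {S T : Set (Fin n)} (h : G m n hm hn S)
    (hT : ∀ i, i ∈ T ↔ dl n hn 2 i ∈ S) : G m n hm hn T := by
  have h0 : ¬ (0 = m - 1) := by omega
  refine Rch.step h 2 ?_ ?_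
  · rw [dl2]; simp
  · intro i
    rw [hT]
    simp [h0]

theorem G.acb (hm3 : 3 ≤ m) {S T : Set (Fin n)} (h : G m n hm hn S)
    (hT : ∀ i, i ∈ T ↔ dl n hn 0 (dl n hn 2 (dl n hn 1 i)) ∈ S) : G m n hm hn T := by
  have h0 : ¬ (0 = m - 1) := by omega
  have h01 : ¬ (1 = m - 1) := by omega
  have h1 := h.a 1 (by omega)
  have h2 : Rch m n hm hn (⟨1, by omega⟩, {i | dl n hn 0 (dl n hn 2 i) ∈ S}) := by
    refine h1.step 2 ?_ ?_
    · rw [dl2]; simp [h01]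
    · intro i
      simp [h01, dl0_sh]
  refine h2.step 1 ?_ ?_
  · rw [dl1 _ _ (by omega)]; rfl
  · intro i
    rw [hT]
    simp [h0]

theorem dl1_inj (hn2 : 2 ≤ n) : Function.Injective (dl n hn 1) := by
  rintro ⟨i, hi⟩ ⟨j, hj⟩ h
  rw [dl1 _ _ hn2, dl1 _ _ hn2] at h
  have := Fin.ext_iff.1 h
  simp only [sw] at this
  apply Fin.ext
  simp only
  split_ifs at this <;> omega

def PP (m n : ℕ) (hm : 0 < m) (hn : 0 < n) (k i : ℕ) : Prop :=
  ∀ S : Set (Fin n), S.ncard = k → (∃ x ∈ S, x.val = i) → G m n hm hn S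

theorem PP.ab (hm3 : 3 ≤ m) (hn3 : 3 ≤ n) {k i i' : ℕ} (h : PP m n hm hn k i')
    (hi : (sw i + 1) % n = i') : PP m n hm hn k i := by
  rintro S hS ⟨x, hx, rfl⟩
  have hinj : Function.Injective (fun i => dl n hn 0 (dl n hn 1 i)) := by
    intro i j hij
    exact dl1_inj (by omega) (sh_inj n hn 1 hij)
  refine (h ((fun i => dl n hn 0 (dl n hn 1 i)) '' S) ?_ ?_).ab hm3 ?_
  · rw [Set.ncard_image_of_injective _ hinj, hS]
  · refine ⟨_, ⟨x, hx, rfl⟩, ?_⟩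
    obtain ⟨x, hx'⟩ := x
    simp only [dl1 n hn (by omega) x hx', dl0_sh, sh]
    exact hi
  · intro i
    exact (hinj.mem_set_image (s := S) (a := i)).symm

theorem PP.all (hm3 : 3 ≤ m) (hn4 : 4 ≤ n) {k : ℕ} (h : PP m n hm hn k (n - 2)) (i : ℕ)
    (hi : i < n) (hi1 : i ≠ 1) : PP m n hm hn k i := by
  have hdown : ∀ j, j ≤ n - 4 → PP m n hm hn k (n - 2 - j) := by
    intro j
    induction j with
    | zero => intro _; exact h
    | succ j ih =>
      intro hj
      refine (ih (by omega)).ab hm3 (by omega) ?_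
      have e : sw (n - 2 - (j + 1)) = n - 2 - (j + 1) := by unfold sw; split_ifs <;> omega
      rw [e, Nat.mod_eq_of_lt (by omega)]; omega
  have h2 : PP m n hm hn k 2 := by
    have := hdown (n - 4) le_rfl
    rwa [show n - 2 - (n - 4) = 2 by omega] at this
  have h0 : PP m n hm hn k 0 := h2.ab hm3 (by omega) (Nat.mod_eq_of_lt (by simp [sw]; omega))
  by_cases hi0 : i = 0
  · rwa [hi0]
  by_cases hil : i = n - 1
  · refine h0.ab hm3 (by omega) ?_
    have e : sw i = n - 1 := by unfold sw; split_ifs <;> omega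
    rw [e, Nat.sub_add_cancel (by omega), Nat.mod_self]
  · have := hdown (n - 2 - i) (by omega)
    rwa [show n - 2 - (n - 2 - i) = i by omega] at this

theorem PP.lap (hm3 : 3 ≤ m) (hn3 : 3 ≤ n) {k : ℕ}
    (ih : ∀ j < k, ∀ S : Set (Fin n), S.ncard = j → G m n hm hn S) :
    PP m n hm hn k (n - 2) := by
  rintro S hS ⟨x, hx, hxv⟩
  refine (ih (S \ {x}).ncard ?_ (sh n hn m '' (S \ {x})) ?_).lapA (by omega) (by omega) ?_
  · rw [← hS]
    exact Set.ncard_sdiff_singleton_lt_of_mem hx (Set.toFinite _)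
  · exact Set.ncard_image_of_injective _ (sh_inj n hn m)
  · intro i
    rw [(sh_inj n hn m).mem_set_image, ← hxv]
    constructor
    · intro hi
      by_cases h : i = x
      · right; rw [h]
      · left; exact ⟨hi, h⟩
    · rintro (h | h)
      · exact h.1
      · rwa [Fin.ext h]

theorem G.all4 (hm3 : 3 ≤ m) (hn4 : 4 ≤ n) : ∀ S, G m n hm hn S := by
  have key : ∀ k, ∀ S : Set (Fin n), S.ncard = k → G m n hm hn S := by
    intro k
    induction k using Nat.strong_induction_on with
    | _ k ih =>
      intro S hS
      have hP := PP.all hm3 hn4 (PP.lap (k := k) hm3 (by omega) ih)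
      by_cases hex : ∃ x ∈ S, x.val ≠ 1
      · obtain ⟨x, hx, h1⟩ := hex
        exact hP x.val x.isLt h1 S hS ⟨x, hx, rfl⟩
      · push Not at hex
        by_cases he : S = ∅
        · rw [he]; exact G.empty
        have hS1 : S = {⟨1, by omega⟩} := by
          obtain ⟨y, hy⟩ := Set.nonempty_iff_ne_empty.2 he
          ext x
          constructor
          · intro hx; exact Fin.ext (hex x hx)
          · intro hx
            have : x = y := by rw [Set.mem_singleton_iff.1 hx]; exact Fin.ext (hex y hy).symm
            rwa [this]
        have hk : k = 1 := by rw [← hS, hS1]; simp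
        subst hk
        have hsing : ∀ x : Fin n, x.val ≠ 1 → G m n hm hn {x} := fun x hx =>
          hP x.val x.isLt hx {x} (by simp) ⟨x, rfl, rfl⟩
        rw [hS1]
        have hc1 : ∀ i : Fin n, i.val = n - 1 → (dl n hn 2 i).val = 0 := by
          rintro ⟨i, hi⟩ h
          rw [dl2]; simp at h; simp [h]
        have hc2 : ∀ i : Fin n, i.val ≠ n - 1 → dl n hn 2 i = i := by
          rintro ⟨i, hi⟩ h
          rw [dl2]; simp at h; simp [h]
        by_cases hmn : m % n = 1
        · refine (hsing (sh n hn (m - 1) ⟨0, hn⟩) ?_).lapBC hm3 (by omega) ?_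
          · change (0 + (m - 1)) % n ≠ 1
            intro h
            have e1 : m ≡ 1 [MOD n] := by
              rw [Nat.ModEq, hmn, Nat.mod_eq_of_lt (by omega)]
            have e2 : m - 1 ≡ 1 [MOD n] := by
              rw [zero_add] at h
              rw [Nat.ModEq, h, Nat.mod_eq_of_lt (by omega)]
            have e3 : m - 1 + 1 ≡ 1 + 1 [MOD n] := e2.add_right 1
            rw [Nat.sub_add_cancel (by omega)] at e3
            have := (e1.symm.trans e3).eq_of_lt_of_lt (by omega) (by omega)
            omega
          · intro i
            rw [Set.mem_singleton_iff, Set.mem_singleton_iff, (sh_inj n hn (m - 1)).eq_iff]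
            by_cases hi : i.val = n - 1
            · have e : dl n hn 2 i = ⟨0, hn⟩ := Fin.ext (hc1 i hi)
              rw [e, dl1 _ _ (by omega)]
              simp only [sw, Fin.ext_iff, if_true]; omega
            · rw [hc2 i hi]
              obtain ⟨i, hi'⟩ := i
              rw [dl1 _ _ (by omega)]
              simp only [sw, Fin.ext_iff] at hi ⊢
              split_ifs <;> first | omega | simp_all
        · refine (hsing (sh n hn (m - 1) ⟨1, by omega⟩) ?_).lapC (by omega) ?_
          · change (1 + (m - 1)) % n ≠ 1
            rwa [show 1 + (m - 1) = m by omega]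
          · intro i
            rw [Set.mem_singleton_iff, Set.mem_singleton_iff, (sh_inj n hn (m - 1)).eq_iff]
            by_cases hi : i.val = n - 1
            · have e : dl n hn 2 i = ⟨0, hn⟩ := Fin.ext (hc1 i hi)
              rw [e]
              simp only [Fin.ext_iff]; omega
            · rw [hc2 i hi]
              simp [hi]
  exact fun S => key _ S rfl

end

def toS (f : Fin 3 → Bool) : Set (Fin 3) := {i | f i = true}

theorem sh3 (k : ℕ) : sh 3 (by omega) k = sh 3 (by omega) (k % 3) := by
  funext i
  apply Fin.ext
  simp [sh]

theorem G.all3 {m : ℕ} {hm : 0 < m} (hm3 : 3 ≤ m) (hn : 0 < 3) : ∀ S, G m 3 hm hn S := by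
  have g1 : G m 3 hm hn (toS ![false, true, false]) := by
    refine G.empty.lapA (by omega) (by omega) ?_
    intro i; simp only [Set.mem_empty_iff_false, false_or, toS, Set.mem_ofPred_eq]
    revert i; decide
  have g12 : G m 3 hm hn (toS ![false, true, true]) := g1.acb hm3 (by
    simp only [toS, Set.mem_ofPred_eq]; clear * -; decide +revert)
  have g01 : G m 3 hm hn (toS ![true, true, false]) := g12.ab hm3 (by
    simp only [toS, Set.mem_ofPred_eq]; clear * -; decide +revert)
  have g012 : G m 3 hm hn (toS ![true, true, true]) := g01.c hm3 (by
    simp only [toS, Set.mem_ofPred_eq]; clear * -; decide +revert)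
  have g02 : G m 3 hm hn (toS ![true, false, true]) := by
    have : (m - 1) % 3 < 3 := Nat.mod_lt _ (by omega)
    have h3 : (m - 1) % 3 = 0 ∨ (m - 1) % 3 = 1 ∨ (m - 1) % 3 = 2 := by omega
    rcases h3 with h | h | h
    · refine g1.lapBC hm3 (by omega) ?_
      rw [sh3, h]; simp only [toS, Set.mem_ofPred_eq]; clear * -; decide +revert
    · refine g1.lapC (by omega) ?_
      rw [sh3, h]; simp only [toS, Set.mem_ofPred_eq]; clear * -; decide +revert
    · refine g01.lapBC hm3 (by omega) ?_
      rw [sh3, h]; simp only [toS, Set.mem_ofPred_eq]; clear * -; decide +revert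
  have g0 : G m 3 hm hn (toS ![true, false, false]) := g02.acb hm3 (by
    simp only [toS, Set.mem_ofPred_eq]; clear * -; decide +revert)
  have g2 : G m 3 hm hn (toS ![false, false, true]) := g0.ab hm3 (by
    simp only [toS, Set.mem_ofPred_eq]; clear * -; decide +revert)
  have g : G m 3 hm hn (toS ![false, false, false]) := by
    convert G.empty (m := m) (n := 3) (hm := hm) (hn := hn)
    ext i
    simp only [toS, Set.mem_ofPred_eq, Set.mem_empty_iff_false]; revert i; decide
  have hall : ∀ a b c, G m 3 hm hn (toS ![a, b, c]) := by
    intro a b c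
    cases a <;> cases b <;> cases c <;> assumption
  classical
  intro S
  have : S = toS ![decide (0 ∈ S), decide (1 ∈ S), decide (2 ∈ S)] := by
    ext i
    fin_cases i <;> simp [toS]
  rw [this]
  exact hall _ _ _

theorem Rch_all {m n : ℕ} {hm : 0 < m} {hn : 0 < n} (hm3 : 3 ≤ m) (hn3 : 3 ≤ n)
    (s : Fin m × Set (Fin n))
    (hs : s.1.val = m - 1 → (⟨n - 1, by omega⟩ : Fin n) ∈ s.2) : Rch m n hm hn s := by
  have hG : ∀ S, G m n hm hn S := by
    by_cases h : n = 3
    · subst h; exact G.all3 hm3 hn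
    · exact G.all4 hm3 (by omega)
  obtain ⟨⟨q, hq⟩, S⟩ := s
  by_cases h : q = m - 1
  · subst h
    convert (hG (sh n hn (m - 1) '' S)).top (by omega) using 2
    ext i
    simp only [Set.mem_ofPred_eq, (sh_inj n hn (m - 1)).mem_set_image]
    constructor
    · exact Or.inl
    · rintro (h | h)
      · exact h
      · have : i = ⟨n - 1, by omega⟩ := Fin.ext h
        rw [this]; exact hs rfl
  · convert (hG (sh n hn q '' S)).a q (by omega) using 2
    ext i
    simp only [Set.mem_ofPred_eq, (sh_inj n hn q).mem_set_image]

theorem Rch_valid {m n : ℕ} {hm : 0 < m} {hn : 0 < n} (hm3 : 3 ≤ m)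
    (w : List (Fin 3)) : ((PD m n hm hn).eval w).1.val = m - 1 →
      (⟨n - 1, by omega⟩ : Fin n) ∈ ((PD m n hm hn).eval w).2 := by
  induction w using List.reverseRecOn with
  | nil =>
    intro h
    have : 0 = m - 1 := h
    omega
  | append_singleton w x ih =>
    rw [DFA.eval_append_singleton]
    intro h
    exact Or.inr ⟨h, rfl⟩

theorem product_with_reversed_tight (m n : ℕ) (hm : 3 ≤ m) (hn : 3 ≤ n) :
    sc (U m (by omega) * rev (U n (by omega))) = (m - 1) * 2 ^ n + 2 ^ (n - 1) - (m - 1) := by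
  have hm0 : 0 < m := by omega
  have hn0 : 0 < n := by omega
  rw [← PD_accepts m n hm0 hn0 (by omega), ← R0_card m n (by omega) (by omega)]
  set R0 := {s : Fin m × Set (Fin n) | (s.1.val = m - 1 → (⟨n - 1, by omega⟩ : Fin n) ∈ s.2) ∧
      (s.2 = Set.univ → s.1.val = 0)} with hR0
  have hrange : Set.range (PD m n hm0 hn0).accepts.leftQuotient =
      (PD m n hm0 hn0).acceptsFrom '' R0 := by
    rw [Language.leftQuotient_accepts]
    ext L
    constructor
    · rintro ⟨w, rfl⟩
      have hv := Rch_valid (hm := hm0) (hn := hn0) hm w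
      simp only [Function.comp]
      by_cases hu : ((PD m n hm0 hn0).eval w).2 = Set.univ
      · refine ⟨(⟨0, hm0⟩, Set.univ), ⟨fun _ => Set.mem_univ _, fun _ => rfl⟩, ?_⟩
        rw [lang_univ _ ((PD m n hm0 hn0).eval w).1, ← hu]
      · exact ⟨_, ⟨hv, fun h => absurd h hu⟩, rfl⟩
    · rintro ⟨s, hs, rfl⟩
      obtain ⟨w, hw⟩ := Rch_all (hm := hm0) (hn := hn0) hm hn s hs.1
      exact ⟨w, by simp [hw]⟩
  have hinj : Set.InjOn (PD m n hm0 hn0).acceptsFrom R0 := by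
    rintro ⟨q, S⟩ hs ⟨q', S'⟩ ht h
    have h2 : S = S' := lang_snd h
    subst h2
    by_contra hne
    have hq : q ≠ q' := fun h => hne (by rw [h])
    by_cases hu : S = Set.univ
    · exact hq (Fin.ext ((hs.2 hu).trans (ht.2 hu).symm))
    · obtain ⟨p, hp⟩ := (Set.ne_univ_iff_exists_notMem S).1 hu
      refine (Win.all (hm := hm0) (hn := hn0) hm hn q q' p hq).2 S hp ?_ h
      rintro (h | h)
      · exact hs.1 h
      · exact ht.1 h
  rw [sc_eq _ (by rw [hrange]; exact Set.toFinite _), hrange, hinj.ncard_image]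
end

section
/- For m, n ≥ 3, the state complexity of (Uₙ(d,c,b,a))ᴿ · (Uₘ(a,b,c,d))ᴿ, which equals the reversal (Uₘ(a,b,c,d)·Uₙ(d,c,b,a))ᴿ of the concatenation, is exactly 3·2^{m+n−2} − 2ⁿ + 1. -/
open SCPaper

open SCPaper

namespace RevProd

open scoped Fin.CommRing

def pre {k : ℕ} (f : Fin k → Fin k) (S : Finset (Fin k)) : Finset (Fin k) :=
  Finset.univ.filter (fun q => f q ∈ S)

lemma mem_pre {k : ℕ} (f : Fin k → Fin k) (S : Finset (Fin k)) (q : Fin k) :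
    q ∈ pre f S ↔ f q ∈ S := by simp [pre]

lemma cyc_eq (k : ℕ) (i : Fin (k+3)) : cyc (k+3) i = i + 1 := by
  apply Fin.ext
  simp [cyc, Fin.val_add]

lemma tp_eq (k : ℕ) (i : Fin (k+3)) : tp01 (k+3) i = if i = 0 then 1 else if i = 1 then 0 else i := by
  simp only [tp01, Fin.ext_iff]
  have h1 : ((1 : Fin (k+3)) : ℕ) = 1 := by simp
  have h0 : ((0 : Fin (k+3)) : ℕ) = 0 := by simp
  rw [h1, h0]
  split_ifs <;> simp

lemma sing_eq (k : ℕ) (i : Fin (k+3)) : sing (k+3) i = if i = Fin.last _ then 0 else i := by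
  simp only [sing, Fin.ext_iff, Fin.val_last]
  have h0 : ((0 : Fin (k+3)) : ℕ) = 0 := by simp
  have : k + 3 - 1 = k + 2 := rfl
  rw [this]
  split_ifs <;> simp

lemma last_add_one (k : ℕ) : (Fin.last (k+2) + 1 : Fin (k+3)) = 0 := by simp

lemma one_ne (k : ℕ) : (1 : Fin (k+3)) ≠ 0 := by simp [Fin.ext_iff]
lemma last_ne_zero (k : ℕ) : Fin.last (k+2) ≠ 0 := by simp [Fin.ext_iff]
lemma last_ne_one (k : ℕ) : Fin.last (k+2) ≠ 1 := by simp [Fin.ext_iff]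

/-- Generic induction: all subsets are generated. -/
theorem gen (k : ℕ) (P : Finset (Fin (k+3)) → Prop) (h1 : ∃ i, P {i})
    (hrot : ∀ S, P S → P (pre (cyc (k+3)) S))
    (hsw : ∀ S, 0 ∉ S → 1 ∈ S → P S → P (pre (tp01 (k+3)) S))
    (hcp : ∀ S, P S → P (pre (sing (k+3)) S)) : ∀ S, P S := by
  have hsh : ∀ (j : ℕ) S, P S → P (pre (fun q => q + (j : Fin (k+3))) S) := by
    intro j
    induction j with
    | zero =>
      intro S h
      have : pre (fun q => q + ((0:ℕ) : Fin (k+3))) S = S := by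
        ext q; simp [mem_pre]
      rwa [this]
    | succ j ih =>
      intro S h
      have := hrot _ (ih S h)
      convert this using 1
      ext q
      simp only [mem_pre, cyc_eq]
      push_cast
      rw [add_assoc, add_comm (j : Fin (k+3)) 1]
  have hshift : ∀ (y : Fin (k+3)) S, P S → P (pre (fun q => q + y) S) := by
    intro y S h
    have := hsh y.val S h
    simpa using this
  have hshift' : ∀ (y : Fin (k+3)) S, P (pre (fun q => q + y) S) → P S := by
    intro y S h
    have := hshift (-y) _ h
    convert this using 1
    ext q
    simp [mem_pre]
  have hsing : ∀ i, P {i} := by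
    obtain ⟨i, hi⟩ := h1
    intro j
    have := hshift (i - j) _ hi
    convert this using 1
    ext q
    simp only [mem_pre, Finset.mem_singleton]
    constructor
    · rintro rfl; simp
    · intro h
      have : q + (i - j) - (i - j) = i - (i - j) := by rw [h]
      simpa using this
  have hcard : ∀ (c : ℕ) S, S.card = c + 1 → P S := by
    intro c
    induction c with
    | zero =>
      intro S hS
      obtain ⟨i, rfl⟩ := Finset.card_eq_one.1 hS
      exact hsing i
    | succ c ih =>
      have hcardsh : ∀ (y : Fin (k+3)) S, (pre (fun q => q + y) S).card = S.card := by
        intro y S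
        apply Finset.card_bij (fun q _ => q + y)
        · intro q hq; exact (mem_pre (fun q => q + y) S q).1 hq
        · intro a _ b _ h; exact add_right_cancel h
        · intro b hb
          exact ⟨b - y, by simpa [mem_pre] using hb, by simp⟩
      have key : ∀ (g : ℕ) S, S.card = c + 1 + 1 → (0 : Fin (k+3)) ∈ S → (g : Fin (k+3)) ∈ S →
          (g : Fin (k+3)) ≠ 0 → P S := by
        intro g
        induction g with
        | zero => intro S _ _ _ h; simp at h
        | succ g ihg =>
          intro S hS h0 hg hg0
          by_cases hone : (1 : Fin (k+3)) ∈ S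
          · apply hshift' 1
            have hc := hcardsh 1 S
            set S1 := pre (fun q => q + 1) S with hS1
            have hl : Fin.last (k+2) ∈ S1 := by rw [hS1, mem_pre, last_add_one]; exact h0
            have hz : (0 : Fin (k+3)) ∈ S1 := by rw [hS1, mem_pre, zero_add]; exact hone
            have h2 := hcp _ (ih (S1.erase (Fin.last _)) (by
              rw [Finset.card_erase_of_mem hl, hc, hS]; rfl))
            convert h2 using 1
            ext q
            rw [mem_pre (sing (k+3)), sing_eq]
            split_ifs with hq
            · subst hq; simp [hl, hz, (last_ne_zero k).symm]
            · simp [hq]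
          · -- move
            have hne : (1 : Fin (k+3)) ≠ 0 := one_ne k
            have hS2c : (insert 1 (S.erase 0)).card = c + 1 + 1 := by
              rw [Finset.card_insert_of_notMem (by simp [hone]), Finset.card_erase_of_mem h0, hS]; rfl
            have hP2 : P (insert 1 (S.erase 0)) := by
              apply hshift' 1
              apply ihg
              · rw [hcardsh]; exact hS2c
              · simp [mem_pre]
              · rw [mem_pre]
                push_cast at hg hg0
                simp [hg, hg0]
              · intro h
                push_cast at hg
                rw [h, zero_add] at hg
                exact hone hg
            have := hsw _ (by simp) (by simp) hP2
            convert this using 1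
            ext q
            rw [mem_pre, tp_eq]
            split_ifs with hq hq'
            · subst hq; simp [h0]
            · subst hq'; simp [hone]
            · simp [hq, hq']
      intro S hS
      obtain ⟨y, hy, z, hz, hyz⟩ := Finset.one_lt_card.1 (by omega : 1 < S.card)
      apply hshift' y
      apply key (z - y).val
      · rw [hcardsh]; exact hS
      · simpa [mem_pre] using hy
      · simpa [mem_pre] using hz
      · simp [sub_eq_zero, hyz.symm]
  intro S
  rcases Nat.eq_zero_or_pos S.card with h | h
  · rw [Finset.card_eq_zero] at h
    subst h
    have := hcp _ (hsing (Fin.last _))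
    convert this using 1
    ext q
    rw [mem_pre, sing_eq]
    split_ifs with hq
    · simpa using (last_ne_zero k).symm
    · simp [hq]
  · exact hcard (S.card - 1) S (by omega)

/-- adding the initial state of the second automaton -/
def add' {n m : ℕ} (S : Finset (Fin (n+3))) (T : Finset (Fin (m+3))) : Finset (Fin (m+3)) :=
  if 0 ∈ S then insert (Fin.last _) T else T

lemma mem_add' {n m : ℕ} (S : Finset (Fin (n+3))) (T : Finset (Fin (m+3))) (q) :
    q ∈ add' S T ↔ q ∈ T ∨ (q = Fin.last _ ∧ 0 ∈ S) := by
  unfold add'; split_ifs with h <;> simp [h, or_comm]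

def KD (m : ℕ) : DFA (Fin 4) (Fin (m+3)) := U4dfa (m+3) (by omega)
def LD (n : ℕ) : DFA (Fin 4) (Fin (n+3)) := U4dcbaDfa (n+3) (by omega)

def D (m n : ℕ) : DFA (Fin 4) (Finset (Fin (n+3)) × Finset (Fin (m+3))) where
  step p x := (pre (fun q => (LD n).step q x) p.1,
    add' (pre (fun q => (LD n).step q x) p.1) (pre (fun q => (KD m).step q x) p.2))
  start := ({Fin.last _}, ∅)
  accept := {p | 0 ∈ p.2}

lemma step0 (m n) (S T) : (D m n).step (S, T) 0 = (S, add' S (pre (cyc (m+3)) T)) := by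
  have : pre (fun q => (LD n).step q 0) S = S := by ext q; simp [mem_pre, LD, U4dcbaDfa]
  simp only [D, this]; rfl
lemma step1 (m n) (S T) : (D m n).step (S, T) 1 =
    (pre (sing (n+3)) S, add' (pre (sing (n+3)) S) (pre (tp01 (m+3)) T)) := rfl
lemma step2 (m n) (S T) : (D m n).step (S, T) 2 =
    (pre (tp01 (n+3)) S, add' (pre (tp01 (n+3)) S) (pre (sing (m+3)) T)) := rfl
lemma step3 (m n) (S T) : (D m n).step (S, T) 3 =
    (pre (cyc (n+3)) S, add' (pre (cyc (n+3)) S) T) := by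
  have : pre (fun q => (KD m).step q 3) T = T := by ext q; simp [mem_pre, KD, U4dfa]
  simp only [D, this]; rfl

lemma eval_char (m n : ℕ) (w : List (Fin 4)) :
    (∀ q, q ∈ ((D m n).eval w).1 ↔ (LD n).evalFrom q w.reverse = Fin.last _) ∧
    (∀ q, q ∈ ((D m n).eval w).2 ↔ ∃ u v, u ++ v = w ∧ (LD n).evalFrom 0 u.reverse = Fin.last _ ∧
      (KD m).evalFrom q v.reverse = Fin.last _) := by
  induction w using List.reverseRecOn with
  | nil =>
    constructor
    · intro q; simp [D]
    · intro q
      simp only [D, DFA.eval_nil, Finset.notMem_empty, false_iff]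
      rintro ⟨u, v, h, h1, -⟩
      obtain ⟨rfl, rfl⟩ := List.append_eq_nil_iff.1 h
      exact last_ne_zero n h1.symm
  | append_singleton w x ih =>
    obtain ⟨ih1, ih2⟩ := ih
    have A : ∀ q, q ∈ ((D m n).eval (w ++ [x])).1 ↔
        (LD n).evalFrom q (w ++ [x]).reverse = Fin.last _ := by
      intro q
      rw [DFA.eval_append_singleton]
      simp only [D, mem_pre]
      rw [List.reverse_append, List.reverse_singleton, List.singleton_append, DFA.evalFrom_cons]
      exact ih1 _
    refine ⟨A, ?_⟩
    intro q
    have hs : ((D m n).eval (w ++ [x])).2 = add' ((D m n).eval (w ++ [x])).1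
        (pre (fun q => (KD m).step q x) ((D m n).eval w).2) := by
      rw [DFA.eval_append_singleton]; rfl
    rw [hs, mem_add', A, mem_pre, ih2]
    constructor
    · rintro (⟨u, v, rfl, h1, h2⟩ | ⟨rfl, h⟩)
      · exact ⟨u, v ++ [x], by simp, h1, by simpa using h2⟩
      · exact ⟨w ++ [x], [], by simp, h, by simp⟩
    · rintro ⟨u, v, huv, h1, h2⟩
      rcases List.eq_nil_or_concat v with rfl | ⟨v', y, rfl⟩
      · right
        rw [List.append_nil] at huv
        subst huv
        exact ⟨by simpa using h2, h1⟩
      · left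
        rw [List.concat_eq_append] at huv h2
        rw [← List.append_assoc] at huv
        obtain ⟨h3, h4⟩ := List.append_inj' huv rfl
        obtain rfl : y = x := by simpa using h4
        exact ⟨u, v', h3, h1, by simpa using h2⟩

lemma D_accepts (m n : ℕ) : (D m n).accepts =
    rev (U4dcba (n+3) (by omega)) * rev (U4 (m+3) (by omega)) := by
  ext w
  rw [DFA.mem_accepts, Language.mem_mul]
  change 0 ∈ ((D m n).eval w).2 ↔ _
  rw [(eval_char m n w).2]
  have hL : ∀ u : List (Fin 4), u ∈ rev (U4dcba (n+3) (by omega)) ↔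
      (LD n).evalFrom 0 u.reverse = Fin.last _ := by
    intro u; rw [Fin.ext_iff]; rfl
  have hK : ∀ u : List (Fin 4), u ∈ rev (U4 (m+3) (by omega)) ↔
      (KD m).evalFrom 0 u.reverse = Fin.last _ := by
    intro u; rw [Fin.ext_iff]; rfl
  constructor
  · rintro ⟨u, v, h, h1, h2⟩
    exact ⟨u, (hL u).2 h1, v, (hK v).2 h2, h⟩
  · rintro ⟨u, h1, v, h2, h⟩
    exact ⟨u, v, h, (hL u).1 h1, (hK v).1 h2⟩

/-- reachability -/
def R (m n : ℕ) (S : Finset (Fin (n+3))) (T : Finset (Fin (m+3))) : Prop :=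
  ∃ w, (D m n).eval w = (S, T)

lemma R_step {m n S T} (x) (h : R m n S T) {S' T'} (he : (D m n).step (S, T) x = (S', T')) :
    R m n S' T' := by
  obtain ⟨w, hw⟩ := h
  exact ⟨w ++ [x], by rw [DFA.eval_append_singleton, hw, he]⟩

lemma R0 {m n S T} (h : R m n S T) : R m n S (add' S (pre (cyc (m+3)) T)) :=
  R_step 0 h (step0 ..)
lemma R1 {m n S T} (h : R m n S T) :
    R m n (pre (sing (n+3)) S) (add' (pre (sing (n+3)) S) (pre (tp01 (m+3)) T)) :=
  R_step 1 h (step1 ..)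
lemma R2 {m n S T} (h : R m n S T) :
    R m n (pre (tp01 (n+3)) S) (add' (pre (tp01 (n+3)) S) (pre (sing (m+3)) T)) :=
  R_step 2 h (step2 ..)
lemma R3 {m n S T} (h : R m n S T) :
    R m n (pre (cyc (n+3)) S) (add' (pre (cyc (n+3)) S) T) :=
  R_step 3 h (step3 ..)

lemma R_congr {m n S T S' T'} (h : R m n S T) (h1 : ∀ q, q ∈ S' ↔ q ∈ S)
    (h2 : ∀ q, q ∈ T' ↔ q ∈ T) : R m n S' T' := by
  have e1 : S' = S := Finset.ext h1
  have e2 : T' = T := Finset.ext h2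
  rw [e1, e2]; exact h

lemma R22 {m n S T} (h0 : 0 ∉ S) (h : R m n S T) : R m n S (pre (sing (m+3)) T) := by
  refine R_congr (R2 (R2 h)) ?_ ?_
  · intro q
    simp only [mem_pre, tp_eq]
    have := one_ne n
    split_ifs <;> simp_all
  · intro q
    have hl := last_ne_zero m
    have h1 := one_ne n
    simp only [mem_pre, mem_add', tp_eq, sing_eq]
    split_ifs <;> simp_all

lemma R11 {m n S T} (hT : Fin.last _ ∈ T) (h : R m n S T) : R m n (pre (sing (n+3)) S) T := by
  refine R_congr (R1 (R1 h)) ?_ ?_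
  · intro q
    have hl := last_ne_zero n
    simp only [mem_pre, sing_eq]
    split_ifs <;> simp_all
  · intro q
    have hl := last_ne_zero m
    have hl' := last_ne_one m
    have h1 := one_ne m
    have hl2 := hl.symm
    have hl3 := hl'.symm
    simp only [mem_pre, mem_add', tp_eq, sing_eq]
    split_ifs <;> simp_all

lemma R3' {m n S T} (hT : Fin.last _ ∈ T) (h : R m n S T) : R m n (pre (cyc (n+3)) S) T := by
  refine R_congr (R3 h) (fun _ => Iff.rfl) ?_
  intro q
  rw [mem_add']
  constructor
  · exact Or.inl
  · rintro (h | ⟨rfl, -⟩)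
    exacts [h, hT]

lemma R2' {m n S T} (hT : Fin.last _ ∈ T) (h1 : 1 ∈ S) (h : R m n S T) :
    R m n (pre (tp01 (n+3)) S) T := by
  refine R_congr (R2 h) (fun _ => Iff.rfl) ?_
  intro q
  simp only [mem_add', mem_pre, tp_eq, sing_eq]
  split_ifs <;> simp_all

lemma R0' {m n S T} (h0 : 0 ∉ S) (h : R m n S T) : R m n S (pre (cyc (m+3)) T) := by
  have := R0 h
  rwa [add', if_neg h0] at this

lemma R1' {m n S T} (h0 : 0 ∉ S) (h1 : Fin.last _ ∉ S) (h : R m n S T) :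
    R m n S (pre (tp01 (m+3)) T) := by
  refine R_congr (R1 h) ?_ ?_
  · intro q
    simp only [mem_pre, sing_eq]
    split_ifs <;> simp_all
  · intro q
    simp only [mem_add', mem_pre, sing_eq]
    have := last_ne_zero n
    simp_all

/-- from `({last}, ∅)` we get `({1}, {last})` -/
lemma R_base (m n : ℕ) : R m n {1} {Fin.last _} := by
  have h : ∀ j : ℕ, j < n + 2 → R m n {Fin.ofNat (n+3) (n + 2 - j)} ∅ := by
    intro j
    induction j with
    | zero =>
      intro _
      refine ⟨[], ?_⟩
      simp only [DFA.eval_nil, D, Prod.mk.injEq, and_true, Finset.singleton_inj]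
      apply Fin.ext
      simp only [Fin.val_ofNat, Fin.val_last]
      rw [Nat.mod_eq_of_lt (by omega)]; rfl
    | succ j ih =>
      intro hj
      have := R3 (ih (by omega))
      have e : pre (cyc (n+3)) {Fin.ofNat (n+3) (n + 2 - j)} = {Fin.ofNat (n+3) (n + 2 - (j+1))} := by
        ext q
        rw [mem_pre, Finset.mem_singleton, Finset.mem_singleton, Fin.ext_iff, Fin.ext_iff]
        simp only [cyc, Fin.val_ofNat]
        rw [Nat.mod_eq_of_lt (by omega : n + 2 - j < n + 3),
          Nat.mod_eq_of_lt (by omega : n + 2 - (j+1) < n + 3)]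
        have := q.isLt
        rcases Nat.lt_or_ge (q.val + 1) (n+3) with h | h
        · rw [Nat.mod_eq_of_lt h]; omega
        · have : q.val + 1 = n + 3 := by omega
          rw [this, Nat.mod_self]; omega
      rw [e, add', if_neg] at this
      · exact this
      · rw [Finset.mem_singleton, Fin.ext_iff]
        simp only [Fin.val_ofNat, Fin.val_zero]
        rw [Nat.mod_eq_of_lt (by omega : n + 2 - (j+1) < n + 3)]
        omega
  have h1 : R m n {1} ∅ := by
    have := h (n+1) (by omega)
    convert this using 2
    apply Fin.ext
    simp
  have h2 : R m n {0} {Fin.last _} := by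
    refine R_congr (R3 h1) ?_ ?_
    · intro q
      simp [mem_pre, cyc_eq]
    · intro q
      simp [mem_pre, cyc_eq, mem_add']
  have h3 : ∀ j : ℕ, R m n {-(j : Fin (n+3))} {Fin.last _} := by
    intro j
    induction j with
    | zero => simpa using h2
    | succ j ih =>
      refine R_congr (R3' (by simp) ih) ?_ (fun _ => Iff.rfl)
      intro q
      simp only [mem_pre, cyc_eq, Finset.mem_singleton]
      push_cast
      rw [neg_add_rev, neg_add_eq_sub, eq_sub_iff_add_eq']
      constructor
      · intro h; rw [← h]; abel
      · intro h; rw [← h]; abel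
  have := h3 (-1 : Fin (n+3)).val
  rwa [Fin.cast_val_eq_self, neg_neg] at this

lemma R_one (m n : ℕ) (T) : R m n {1} T := by
  have a0 : (0 : Fin (n+3)) ∉ ({1} : Finset (Fin (n+3))) := by simp
  have a1 : Fin.last (n+2) ∉ ({1} : Finset (Fin (n+3))) := by simpa using last_ne_one n
  exact gen m (fun T => R m n {1} T) ⟨_, R_base m n⟩ (fun _ h => R0' a0 h)
    (fun _ _ _ h => R1' a0 a1 h) (fun _ h => R22 a0 h) T

lemma R_last (m n : ℕ) (S T) (hT : Fin.last _ ∈ T) : R m n S T :=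
  gen n (fun S => R m n S T) ⟨_, R_one m n T⟩ (fun _ h => R3' hT h)
    (fun _ _ h1 h => R2' hT h1 h) (fun _ h => R11 hT h) S


lemma R_rot {m n S T} (h0 : 0 ∉ S) (h : R m n S T) (j : ℕ) :
    R m n S (pre (fun q => q + (j : Fin (m+3))) T) := by
  induction j with
  | zero => exact R_congr h (fun _ => Iff.rfl) (by intro q; simp [mem_pre])
  | succ j ih =>
    refine R_congr (R0' h0 ih) (fun _ => Iff.rfl) ?_
    intro q
    simp only [mem_pre, cyc_eq]
    push_cast
    rw [add_assoc, add_comm (j : Fin (m+3)) 1]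

lemma R_all (m n : ℕ) (S T) (hST : 0 ∈ S → Fin.last _ ∈ T) : R m n S T := by
  by_cases h0 : 0 ∈ S
  · exact R_last m n S T (hST h0)
  · rcases T.eq_empty_or_nonempty with rfl | ⟨y, hy⟩
    · refine R_congr (R22 h0 (R_last m n S {Fin.last _} (by simp))) (fun _ => Iff.rfl) ?_
      intro q
      have := (last_ne_zero m).symm
      rw [mem_pre, sing_eq]
      split_ifs <;> simp_all
    · have h := R_last m n S (pre (fun q => q + (1 + y)) T) (by
        rw [mem_pre, ← add_assoc, last_add_one, zero_add]; exact hy)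
      refine R_congr (R_rot h0 h (-(1 + y) : Fin (m+3)).val) (fun _ => Iff.rfl) ?_
      intro q
      rw [mem_pre, mem_pre, Fin.cast_val_eq_self, neg_add_cancel_right]

/-! ### Distinguishability -/

def E (m n : ℕ) (p p' : Finset (Fin (n+3)) × Finset (Fin (m+3))) : Prop :=
  (D m n).acceptsFrom p = (D m n).acceptsFrom p'

lemma E_step {m n p p'} (x) (h : E m n p p') : E m n ((D m n).step p x) ((D m n).step p' x) := by
  unfold E at *
  ext w
  have : x :: w ∈ (D m n).acceptsFrom p ↔ x :: w ∈ (D m n).acceptsFrom p' := by rw [h]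
  simpa [DFA.mem_acceptsFrom] using this

lemma exists_pred {k : ℕ} {q : Fin (k+3)} {j : ℕ} (hq : q.val = j + 1) :
    ∃ q' : Fin (k+3), q'.val = j ∧ q' ≠ Fin.last _ ∧ cyc (k+3) q' = q := by
  have hlt := q.isLt
  refine ⟨⟨j, by omega⟩, rfl, ?_, ?_⟩
  · intro h
    rw [Fin.ext_iff] at h
    simp only [Fin.val_last] at h
    omega
  · apply Fin.ext
    simp only [cyc]
    rw [Nat.mod_eq_of_lt (by omega)]
    exact hq.symm

lemma eval_a (m n : ℕ) (S) (j : ℕ) : ∀ (T) (q : Fin (m+3)), q.val = j →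
    (0 ∈ ((D m n).evalFrom (S, T) (List.replicate j 0)).2 ↔ q ∈ T) := by
  induction j with
  | zero =>
    intro T q hq
    have : q = 0 := Fin.ext hq
    subst this
    simp
  | succ j ih =>
    intro T q hq
    obtain ⟨q', h1, h2, h3⟩ := exists_pred hq
    rw [List.replicate_succ, DFA.evalFrom_cons, step0, ih _ q' h1, mem_add', mem_pre, h3]
    simp [h2]

lemma E_T {m n S T S' T'} (h : E m n (S, T) (S', T')) : T = T' := by
  ext q
  rw [← eval_a m n S q.val T q rfl, ← eval_a m n S' q.val T' q rfl]
  have : List.replicate q.val 0 ∈ (D m n).acceptsFrom (S, T) ↔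
    List.replicate q.val 0 ∈ (D m n).acceptsFrom (S', T') := by rw [h]
  exact this

lemma E_0 {m n S S'} (h0 : 0 ∈ S) (h0' : 0 ∉ S') (j : ℕ) : ∀ (T) (q : Fin (m+3)), q.val = j →
    E m n (S, T) (S', T) → q ∈ T := by
  induction j with
  | zero =>
    intro T q hq hE
    have : q = 0 := Fin.ext hq
    subst this
    have h1 := E_step 0 hE
    rw [step0, step0] at h1
    have h2 := E_T h1
    have h3 : Fin.last _ ∈ add' S (pre (cyc (m+3)) T) := by rw [mem_add']; exact Or.inr ⟨rfl, h0⟩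
    rw [h2, mem_add', mem_pre, cyc_eq, last_add_one] at h3
    simpa [h0'] using h3
  | succ j ih =>
    intro T q hq hE
    obtain ⟨q', h1, h2, h3⟩ := exists_pred hq
    have h4 := E_step 0 hE
    rw [step0, step0] at h4
    have h5 := E_T h4
    rw [h5] at h4
    have h6 := ih _ q' h1 h4
    rw [mem_add', mem_pre, h3] at h6
    simpa [h2] using h6

lemma E_main {m n} (p : Fin (m+3)) (hp : p ≠ Fin.last _) (j : ℕ) : ∀ (S S' T)
    (q : Fin (n+3)), q.val = j → p ∉ T → E m n (S, T) (S', T) → (q ∈ S ↔ q ∈ S') := by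
  induction j with
  | zero =>
    intro S S' T q hq hT hE
    have : q = 0 := Fin.ext hq
    subst this
    constructor
    · intro h; by_contra h'
      exact hT (E_0 h h' _ T p rfl hE)
    · intro h; by_contra h'
      exact hT (E_0 h h' _ T p rfl hE.symm)
  | succ j ih =>
    intro S S' T q hq hT hE
    obtain ⟨q', h1, h2, h3⟩ := exists_pred hq
    have h4 := E_step 3 hE
    rw [step3, step3] at h4
    have h5 := E_T h4
    rw [h5] at h4
    have h6 := ih _ _ _ q' h1 (by rw [mem_add']; simp [hp, hT]) h4
    rwa [mem_pre, mem_pre, h3] at h6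

def Valid {m n : ℕ} (p : Finset (Fin (n+3)) × Finset (Fin (m+3))) : Prop :=
  0 ∈ p.1 → Fin.last _ ∈ p.2

lemma E_S {m n S S' T} (hT : T ≠ Finset.univ) (v : Valid (m := m) (n := n) (S, T))
    (v' : Valid (m := m) (n := n) (S', T)) (hE : E m n (S, T) (S', T)) : S = S' := by
  by_cases h : ∃ p, p ∉ T ∧ p ≠ Fin.last _
  · obtain ⟨p, hp, hp'⟩ := h
    ext q
    exact E_main p hp' _ S S' T q rfl hp hE
  · have hl : Fin.last _ ∉ T := by
      intro hl
      apply hT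
      ext q
      simp only [Finset.mem_univ, iff_true]
      by_contra hq
      exact h ⟨q, hq, by rintro rfl; exact hq hl⟩
    have h0 : 0 ∉ S := fun h => hl (v h)
    have h0' : 0 ∉ S' := fun h => hl (v' h)
    have h1 := E_step 0 hE
    rw [step0, step0, add', if_neg h0, add', if_neg h0'] at h1
    obtain ⟨q', e1, e2, e3⟩ := exists_pred (q := Fin.last (m+2)) (j := m+1) rfl
    ext q
    exact E_main q' e2 _ S S' _ q rfl (by rw [mem_pre, e3]; exact hl) h1

lemma full_eval (m n : ℕ) (w : List (Fin 4)) : ∀ S,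
    ((D m n).evalFrom (S, Finset.univ) w).2 = Finset.univ := by
  induction w with
  | nil => intro S; rfl
  | cons x w ih =>
    intro S
    rw [DFA.evalFrom_cons]
    have : (D m n).step (S, Finset.univ) x =
        (((D m n).step (S, Finset.univ) x).1, Finset.univ) := by
      refine Prod.ext rfl ?_
      ext q
      simp [D, mem_add', mem_pre]
    rw [this]
    exact ih _

lemma full_E (m n : ℕ) (S S') : E m n (S, Finset.univ) (S', Finset.univ) := by
  unfold E
  ext w
  rw [DFA.mem_acceptsFrom, DFA.mem_acceptsFrom]
  change 0 ∈ ((D m n).evalFrom (S, Finset.univ) w).2 ↔ 0 ∈ ((D m n).evalFrom (S', Finset.univ) w).2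
  rw [full_eval, full_eval]

lemma valid_eval (m n : ℕ) (w) : Valid ((D m n).eval w) := by
  induction w using List.reverseRecOn with
  | nil => intro h; simp [D] at h
  | append_singleton w x ih =>
    rw [DFA.eval_append_singleton]
    intro h
    change _ ∈ add' _ _
    rw [mem_add']
    exact Or.inr ⟨rfl, h⟩

/-! ### State complexity as number of quotients -/

lemma sc_eq {α : Type} (L : Language α) (hf : (Set.range L.leftQuotient).Finite) :
    sc L = (Set.range L.leftQuotient).ncard := by
  apply le_antisymm
  · apply Nat.sInf_le
    have := hf.to_subtype
    let e : Set.range L.leftQuotient ≃ Fin (Set.range L.leftQuotient).ncard :=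
      Finite.equivFinOfCardEq rfl
    exact ⟨DFA.reindex e L.toDFA, by simp⟩
  · apply le_csInf
    · have := hf.to_subtype
      let e : Set.range L.leftQuotient ≃ Fin (Set.range L.leftQuotient).ncard :=
        Finite.equivFinOfCardEq rfl
      exact ⟨_, DFA.reindex e L.toDFA, by simp⟩
    · rintro k ⟨M, rfl⟩
      rw [Language.leftQuotient_accepts]
      calc _ ≤ (Set.range M.acceptsFrom).ncard :=
            Set.ncard_le_ncard (Set.range_comp_subset_range _ _) (Set.toFinite _)
        _ ≤ (Set.univ : Set (Fin k)).ncard := by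
            rw [← Set.image_univ]; exact Set.ncard_image_le (Set.toFinite _)
        _ = k := by simp

open Classical in
noncomputable def W (m n : ℕ) : Finset (Finset (Fin (n+3)) × Finset (Fin (m+3))) :=
  Finset.univ.filter (fun p => Valid p ∧ p.2 ≠ Finset.univ)

lemma mem_W (m n : ℕ) (p) : p ∈ W m n ↔ Valid p ∧ p.2 ≠ Finset.univ := by simp [W]

lemma range_eq (m n : ℕ) : Set.range ((D m n).accepts.leftQuotient) =
    (D m n).acceptsFrom '' (insert (Finset.univ, Finset.univ) (W m n : Set _)) := by
  rw [Language.leftQuotient_accepts, Set.range_comp]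
  apply Set.Subset.antisymm
  · rintro _ ⟨_, ⟨w, rfl⟩, rfl⟩
    by_cases h : ((D m n).eval w).2 = Finset.univ
    · refine ⟨_, Set.mem_insert _ _, ?_⟩
      have := full_E m n Finset.univ ((D m n).eval w).1
      rw [← h] at this
      nth_rw 1 [h] at this
      exact this
    · exact ⟨_, Set.mem_insert_of_mem _ (by
        rw [Finset.mem_coe, mem_W]; exact ⟨valid_eval m n w, h⟩), rfl⟩
  · apply Set.image_mono
    rintro ⟨S, T⟩ (h | h)
    · exact R_all m n S T (by rw [Prod.mk.injEq] at h; rw [h.2]; simp)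
    · rw [Finset.mem_coe, mem_W] at h
      exact R_all m n S T h.1

lemma injOn (m n : ℕ) : Set.InjOn (D m n).acceptsFrom
    (insert (Finset.univ, Finset.univ) (W m n : Set _)) := by
  rintro ⟨S, T⟩ h ⟨S', T'⟩ h' hE
  obtain rfl := E_T hE
  rcases h with h | h
  · rcases h' with h' | h'
    · rw [h, h']
    · rw [Finset.mem_coe, mem_W] at h'
      rw [Prod.mk.injEq] at h
      exact absurd h.2 h'.2
  · rw [Finset.mem_coe, mem_W] at h
    rcases h' with h' | h'
    · rw [Prod.mk.injEq] at h'
      exact absurd h'.2 h.2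
    · rw [Finset.mem_coe, mem_W] at h'
      rw [E_S h.2 h.1 h'.1 hE]

lemma card_notMem (k : ℕ) (a : Fin (k+3)) :
    (Finset.univ.filter (fun S : Finset (Fin (k+3)) => a ∉ S)).card = 2 ^ (k+2) := by
  have : Finset.univ.filter (fun S : Finset (Fin (k+3)) => a ∉ S) =
      (Finset.univ.erase a).powerset := by
    ext S
    simp only [Finset.mem_filter, Finset.mem_univ, true_and, Finset.mem_powerset,
      Finset.subset_erase, Finset.subset_univ]
  rw [this, Finset.card_powerset, Finset.card_erase_of_mem (Finset.mem_univ _)]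
  simp

lemma card_mem (k : ℕ) (a : Fin (k+3)) :
    (Finset.univ.filter (fun S : Finset (Fin (k+3)) => a ∈ S)).card = 2 ^ (k+2) := by
  have h := Finset.card_filter_add_card_filter_not (s := (Finset.univ : Finset (Finset (Fin (k+3)))))
    (fun S => a ∈ S)
  rw [card_notMem, Finset.card_univ, Fintype.card_finset, Fintype.card_fin, pow_succ 2 (k+2)] at h
  omega

lemma card_W (m n : ℕ) : (W m n).card + 2 ^ (n+3) = 3 * 2 ^ (m + n + 4) := by
  classical
  set B : Finset (Finset (Fin (n+3)) × Finset (Fin (m+3))) :=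
    (Finset.univ.filter (fun S : Finset (Fin (n+3)) => 0 ∈ S)) ×ˢ
    (Finset.univ.filter (fun T : Finset (Fin (m+3)) => Fin.last _ ∉ T)) with hB
  set F : Finset (Finset (Fin (n+3)) × Finset (Fin (m+3))) :=
    Finset.univ ×ˢ {Finset.univ} with hF
  have hBc : B.card = 2 ^ (n+2) * 2 ^ (m+2) := by
    rw [hB, Finset.card_product, card_mem, card_notMem]
  have hFc : F.card = 2 ^ (n+3) := by
    rw [hF, Finset.card_product, Finset.card_univ, Fintype.card_finset, Fintype.card_fin]; simp
  have d1 : Disjoint (W m n) F := by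
    rw [Finset.disjoint_left]
    intro p h1 h2
    rw [mem_W] at h1
    simp only [hF, Finset.mem_product, Finset.mem_singleton] at h2
    exact h1.2 h2.2
  have d2 : Disjoint (W m n ∪ F) B := by
    rw [Finset.disjoint_left]
    intro p h1 h2
    simp only [hB, Finset.mem_product, Finset.mem_filter, Finset.mem_univ, true_and] at h2
    rcases Finset.mem_union.1 h1 with h1 | h1
    · rw [mem_W] at h1
      exact h2.2 (h1.1 h2.1)
    · simp only [hF, Finset.mem_product, Finset.mem_singleton] at h1
      apply h2.2
      rw [h1.2]; simp
  have hu : W m n ∪ F ∪ B = Finset.univ := by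
    ext p
    simp only [Finset.mem_union, mem_W, hF, hB, Finset.mem_product, Finset.mem_singleton,
      Finset.mem_filter, Finset.mem_univ, true_and, iff_true, Valid]
    tauto
  have := congrArg Finset.card hu
  rw [Finset.card_union_of_disjoint d2, Finset.card_union_of_disjoint d1, hBc, hFc,
    Finset.card_univ, Fintype.card_prod, Fintype.card_finset, Fintype.card_finset,
    Fintype.card_fin, Fintype.card_fin] at this
  have e1 : 2 ^ (n+2) * 2 ^ (m+2) = 2 ^ (m+n+4) := by rw [← pow_add]; congr 1; omega
  have e2 : 2 ^ (n+3) * 2 ^ (m+3) = 4 * 2 ^ (m+n+4) := by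
    rw [← pow_add, show n + 3 + (m + 3) = m + n + 4 + 2 by omega, pow_add]; omega
  omega

theorem sc_main (m n : ℕ) : sc (rev (U4dcba (n+3) (by omega)) * rev (U4 (m+3) (by omega))) =
    3 * 2 ^ (m + 3 + (n + 3) - 2) - 2 ^ (n+3) + 1 := by
  rw [← D_accepts, sc_eq, range_eq, (injOn m n).ncard_image,
    Set.ncard_insert_of_notMem, Set.ncard_coe_finset]
  · have := card_W m n
    rw [show m + 3 + (n + 3) - 2 = m + n + 4 by omega]
    omega
  · rw [Finset.mem_coe, mem_W]
    simp
  · rw [range_eq]; exact Set.toFinite _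

end RevProd

theorem reversal_of_product_tight (m n : ℕ) (hm : 3 ≤ m) (hn : 3 ≤ n) :
    rev (U4 m (by omega) * U4dcba n (by omega)) =
      rev (U4dcba n (by omega)) * rev (U4 m (by omega)) ∧
    sc (rev (U4dcba n (by omega)) * rev (U4 m (by omega))) =
      3 * 2 ^ (m + n - 2) - 2 ^ n + 1 := by
  refine ⟨Language.reverse_mul _ _, ?_⟩
  obtain ⟨m, rfl⟩ := Nat.exists_eq_add_of_le' hm
  obtain ⟨n, rfl⟩ := Nat.exists_eq_add_of_le' hn
  exact RevProd.sc_main m n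
end
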